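/- arXiv:2006.11616 — 2 statements merged into one kernel-verified Lean document; each statement's English description precedes it below -/
import Mathlib

section
/- Fix n ≥ 1. Let L be the automorphism of ℤⁿ cyclically permuting the standard basis (L(ē_i) = ē_{i+1} for i < n, L(ē_n) = ē₁), and let G = ℤⁿ ⋊_L ℤ with multiplication (u,k)·(w,l) = (u + L^k w, k + l). Set e₀ = (0,1), e_i = (ē_i, 0) for 1 ≤ i ≤ n, and e_{n+1} = e₀ⁿ = (0,n). Then for every unitary representation 𝒰 of G on a separable Hilbert space H such that the unitary U_{e₁ − L^r e₁} has no non-trivial fixed vectors for every 1 ≤ r < n, the essential values of the multiplicity function of U_{e_{n+1}} are contained in the set of multiples of n. If in addition U_{e₀} has simple spectrum, then U_{e_{n+1}} has uniform multiplicity n. (Ageev, Danilenko) -/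
open MeasureTheory
open scoped ENNReal

attribute [local instance] ZeroLEOneClass.factZeroLtOne

/-- The automorphism `L` of `ℤⁿ` cyclically permuting the standard basis:
`L(ēᵢ) = ē_{i+1}` (indices mod `n`), i.e. `(L v) j = v (j - 1)`. -/
def cyclicShift (n : ℕ) [NeZero n] : (Fin n → ℤ) ≃+ (Fin n → ℤ) where
  toFun v j := v (j - 1)
  invFun v j := v (j + 1)
  left_inv v := by funext j; simp
  right_inv v := by funext j; simp
  map_add' v w := rfl

/-- The group `G = ℤⁿ ⋊_L ℤ` with multiplication `(u,k)·(w,l) = (u + Lᵏ w, k + l)`. -/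
abbrev AgeevGroup (n : ℕ) [NeZero n] :=
  SemidirectProduct (Multiplicative (Fin n → ℤ)) (Multiplicative ℤ)
    (zpowersHom _ (AddEquiv.toMultiplicative (cyclicShift n)))

/-- The element `e₀ = (0, 1)` of `ℤⁿ ⋊_L ℤ`. -/
def e₀ (n : ℕ) [NeZero n] : AgeevGroup n :=
  SemidirectProduct.inr (Multiplicative.ofAdd (1 : ℤ))

/-- The element `e_{n+1} = e₀ⁿ = (0, n)` of `ℤⁿ ⋊_L ℤ`. -/
def eTop (n : ℕ) [NeZero n] : AgeevGroup n :=
  SemidirectProduct.inr (Multiplicative.ofAdd (n : ℤ))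

/-- The element `e₁ - Lʳ e₁ = (ē₁ - ē_{1+r}, 0)` of `ℤⁿ ⋊_L ℤ` (`0`-indexed: `ē₁` is
`Pi.single 0 1` and `Lʳ ē₁ = Pi.single r 1`). -/
def eDiff (n : ℕ) [NeZero n] (r : Fin n) : AgeevGroup n :=
  SemidirectProduct.inl (Multiplicative.ofAdd
    (Pi.single (0 : Fin n) (1 : ℤ) - Pi.single r (1 : ℤ)))

variable {H : Type*} [NormedAddCommGroup H] [InnerProductSpace ℂ H] [CompleteSpace H]

/-- The cyclic space generated by `x` under the unitary operator `V`. -/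
def zCyclicSpace (V : H ≃ₗᵢ[ℂ] H) (x : H) : Submodule ℂ H :=
  Submodule.span ℂ {y : H | ∃ n : ℤ, y = (V ^ n) x}

/-- A spectral decomposition of the (separable) Hilbert space `H` for a unitary operator
`V`: orthogonal cyclic subspaces generated by `x i`, jointly total, with spectral measures
`σ i` (on the circle `ℝ/ℤ`, the dual of `ℤ`) forming a decreasing chain. -/
structure IsSpectralDecompositionZ (V : H ≃ₗᵢ[ℂ] H) (x : ℕ → H)
    (σ : ℕ → Measure (AddCircle (1 : ℝ))) : Prop where
  spectral : ∀ i, ∀ m : ℤ,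
    (inner ℂ ((V ^ m) (x i)) (x i) : ℂ) = ∫ θ : AddCircle (1 : ℝ), fourier m θ ∂(σ i)
  finite : ∀ i, IsFiniteMeasure (σ i)
  chain : ∀ i, σ (i + 1) ≪ σ i
  orthogonal : ∀ i j, i ≠ j → ∀ v ∈ zCyclicSpace V (x i), ∀ w ∈ zCyclicSpace V (x j),
    (inner ℂ v w : ℂ) = 0
  total : (⨆ i, zCyclicSpace V (x i)).topologicalClosure = ⊤

/-- The multiplicity function of a spectral decomposition with spectral sequence `σ`:
`M(χ) = Σᵢ 1_{Yᵢ}(χ)` where `Yᵢ` is the support of `dσᵢ/dσ₀`. -/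
noncomputable def multiplicityFun (σ : ℕ → Measure (AddCircle (1 : ℝ)))
    (χ : AddCircle (1 : ℝ)) : ℝ≥0∞ :=
  ∑' i : ℕ, if (σ i).rnDeriv (σ 0) χ ≠ 0 then (1 : ℝ≥0∞) else 0

section SpectralMultiplicity

open Module

lemma mem_maxGenEigenspace_apply_iff {K : Type*} [AddCommGroup K] [Module ℂ K]
    {f g : End ℂ K} (w : K ≃ₗ[ℂ] K) (h : ∀ v, w (f v) = g (w v)) (c : ℂ) (v : K) :
    w v ∈ g.maxGenEigenspace c ↔ v ∈ f.maxGenEigenspace c := by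
  have hpow (k : ℕ) : ((g - c • 1) ^ k) (w v) = w (((f - c • 1) ^ k) v) := by
    induction k with
    | zero => simp
    | succ k ih => simp [pow_succ', ih, h]
  simp [End.mem_maxGenEigenspace, hpow]

/-- If two commuting endomorphisms have a common nonzero generalised eigenvector for the same
eigenvalue, they agree on some nonzero vector. -/
lemma eq_zero_of_mem_maxGenEigenspace {K : Type*} [AddCommGroup K] [Module ℂ K]
    {f g : End ℂ K} (hfg : Commute f g) (hinj : ∀ v, f v = g v → v = 0) {c : ℂ} {v : K}
    (hf : v ∈ f.maxGenEigenspace c) (hg : v ∈ g.maxGenEigenspace c) : v = 0 := by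
  rw [End.mem_maxGenEigenspace] at hf hg
  obtain ⟨k, hk⟩ := hf
  obtain ⟨l, hl⟩ := hg
  have hcomm : Commute (f - c • 1) (-(g - c • 1)) := by
    refine Commute.neg_right (Commute.sub_left (Commute.sub_right hfg ?_) ?_)
    · exact (Commute.one_right f).smul_right c
    · exact (Commute.one_left _).smul_left c
  have hpow : ((f - g) ^ (k + l)) v = 0 := by
    have : f - g = (f - c • 1) + -(g - c • 1) := by abel
    rw [this, hcomm.add_pow, LinearMap.sum_apply]
    refine Finset.sum_eq_zero fun m hm => ?_
    rw [← Nat.cast_comm, ← nsmul_eq_mul, LinearMap.smul_apply]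
    by_cases hmk : k ≤ m
    · obtain ⟨d, rfl⟩ := Nat.exists_eq_add_of_le' hmk
      rw [(hcomm.pow_pow _ _).eq, pow_add _ d k]
      simp [Module.End.mul_apply, hk]
    · have : l ≤ k + l - m := by omega
      obtain ⟨d, hd⟩ := Nat.exists_eq_add_of_le' this
      rw [hd, pow_add _ d l, neg_pow _ l]
      simp [Module.End.mul_apply, hl]
  have hinj' : Function.Injective (f - g) := by
    rw [injective_iff_map_eq_zero]
    exact fun u hu => hinj u (sub_eq_zero.mp hu)
  have : Function.Injective ((f - g) ^ (k + l)) := by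
    rw [Module.End.coe_pow]; exact hinj'.iterate _
  exact this (by simpa using hpow)

lemma Fin.add_one_induction {n : ℕ} [NeZero n] {p : Fin n → Prop} (zero : p 0)
    (step : ∀ i, p i → p (i + 1)) (i : Fin n) : p i := by
  have h (m : ℕ) : p (Fin.ofNat n m) := by
    induction m with
    | zero => exact zero
    | succ m ih =>
      have := step _ ih
      rwa [show Fin.ofNat n (m + 1) = Fin.ofNat n m + 1 by
        ext; simp [Fin.val_add]]
  simpa using h i

lemma existsUnique_argmin {n : ℕ} [NeZero n] {c : Fin n → ℂ} (hc : Function.Injective c) :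
    ∃! j, ∀ i, toLex ((c j).re, (c j).im) ≤ toLex ((c i).re, (c i).im) := by
  obtain ⟨j, hj⟩ := Finite.exists_min (fun i => toLex ((c i).re, (c i).im))
  refine ⟨j, hj, fun l hl => hc ?_⟩
  have := le_antisymm (hl j) (hj l)
  simp only [EmbeddingLike.apply_eq_iff_eq, Prod.mk.injEq] at this
  exact Complex.ext this.1 this.2

theorem dvd_finrank_of_cyclic_conjugation {n : ℕ} [NeZero n] {K : Type*} [AddCommGroup K]
    [Module ℂ K] [FiniteDimensional ℂ K] (A : Fin n → End ℂ K) (hA : ∀ i j, Commute (A i) (A j))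
    (w : K ≃ₗ[ℂ] K) (hw : ∀ i v, w (A i v) = A (i + 1) (w v))
    (hinj : ∀ i j, i ≠ j → ∀ v, A i v = A j v → v = 0) : n ∣ finrank ℂ K := by
  classical
  let N : (Fin n → ℂ) → Submodule ℂ K := fun c => ⨅ i, (A i).maxGenEigenspace (c i)
  have hmaps (i j : Fin n) (φ : ℂ) :
      Set.MapsTo (A i) ((A j).maxGenEigenspace φ) ((A j).maxGenEigenspace φ) :=
    End.mapsTo_maxGenEigenspace_of_comm (hA j i) φ
  have hind : iSupIndep N := End.independent_iInf_maxGenEigenspace_of_forall_mapsTo A hmaps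
  have htop : ⨆ c, N c = ⊤ := End.iSup_iInf_maxGenEigenspace_eq_top_of_forall_mapsTo A hmaps
    fun i => End.iSup_maxGenEigenspace_eq_top _
  have hfin : {c | N c ≠ ⊥}.Finite := WellFoundedGT.finite_ne_bot_of_iSupIndep hind
  let d : (Fin n → ℂ) → ℕ := fun c => finrank ℂ (N c)
  have hsum : finrank ℂ K = ∑ c ∈ hfin.toFinset, d c := by
    have := LinearMap.trace_eq_sum_trace_restrict'
      (DirectSum.isInternal_submodule_of_iSupIndep_of_iSup_eq_top hind htop) hfin
      (f := LinearMap.id) (fun i => Set.mapsTo_id _)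
    simp only [LinearMap.trace_id] at this
    exact_mod_cast this.trans (Finset.sum_congr rfl fun c _ => LinearMap.trace_id ℂ (N c))
  let T : (Fin n → ℂ) ≃ (Fin n → ℂ) := Equiv.arrowCongr (Equiv.addRight 1) (Equiv.refl _)
  have hT (c : Fin n → ℂ) (i : Fin n) : T c (i + 1) = c i := by simp [T]
  have hmem (c : Fin n → ℂ) (v : K) : w v ∈ N (T c) ↔ v ∈ N c := by
    simp only [N, Submodule.mem_iInf]
    rw [← (Equiv.addRight (1 : Fin n)).forall_congr_right]
    refine forall_congr' fun i => ?_
    simp only [Equiv.coe_addRight, hT]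
    exact mem_maxGenEigenspace_apply_iff w (hw i) _ v
  have hmap (c : Fin n → ℂ) : (N c).map (w : K →ₗ[ℂ] K) = N (T c) := by
    ext v
    obtain ⟨u, rfl⟩ := w.surjective v
    simp [hmem]
  have hdT (c : Fin n → ℂ) : d (T c) = d c := by
    change finrank ℂ (N (T c)) = finrank ℂ (N c)
    rw [← hmap]
    exact LinearEquiv.finrank_map_eq w (N c)
  have hbot (c : Fin n → ℂ) : N (T c) ≠ ⊥ ↔ N c ≠ ⊥ := by
    simp only [ne_eq, ← Submodule.finrank_eq_zero (R := ℂ)]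
    exact not_congr (by rw [show finrank ℂ (N (T c)) = finrank ℂ (N c) from hdT c])
  have hcinj (c : Fin n → ℂ) (hc : N c ≠ ⊥) : Function.Injective c := by
    intro i j hij
    by_contra hne
    obtain ⟨v, hv, hv0⟩ := Submodule.exists_mem_ne_zero_of_ne_bot hc
    simp only [N, Submodule.mem_iInf] at hv
    exact hv0 (eq_zero_of_mem_maxGenEigenspace (hA i j) (hinj i j hne) (hv i) (hij ▸ hv j))
  let P : Fin n → (Fin n → ℂ) → Prop := fun j c =>
    ∀ i, toLex ((c j).re, (c j).im) ≤ toLex ((c i).re, (c i).im)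
  have hPT (j : Fin n) (c : Fin n → ℂ) : P (j + 1) (T c) ↔ P j c := by
    simp only [P, hT]
    rw [← (Equiv.addRight (1 : Fin n)).forall_congr_right]
    simp [hT]
  let D : Fin n → ℕ := fun j => ∑ c ∈ hfin.toFinset with P j c, d c
  have hD (j : Fin n) : D (j + 1) = D j := by
    symm
    refine Finset.sum_equiv T (fun c => ?_) (fun c _ => (hdT c).symm)
    simp [hPT, hbot]
  have hDconst (j : Fin n) : D j = D 0 := by
    induction j using Fin.add_one_induction with
    | zero => rfl
    | step j ih => rw [hD, ih]
  have hfinal : ∑ c ∈ hfin.toFinset, d c = ∑ j, D j := by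
    simp only [D, Finset.sum_filter]
    rw [Finset.sum_comm]
    refine Finset.sum_congr rfl fun c hc => ?_
    obtain ⟨j, hj, hju⟩ := existsUnique_argmin (hcinj c (by simpa using hc))
    rw [Finset.sum_eq_single j (fun l _ hl => if_neg fun h => hl (hju l h)) (by simp), if_pos hj]
  rw [hsum, hfinal, Finset.sum_congr rfl fun j _ => hDconst j]
  simp

section AgeevGroup

variable {n : ℕ} [NeZero n]

lemma cyclicShift_single (i : Fin n) :
    cyclicShift n (Pi.single i 1) = Pi.single (i + 1) 1 := by
  funext j
  simp [cyclicShift, Pi.single_apply, sub_eq_iff_eq_add]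

lemma e₀_mul_inl (v : Fin n → ℤ) :
    e₀ n * SemidirectProduct.inl (Multiplicative.ofAdd v) =
      SemidirectProduct.inl (Multiplicative.ofAdd (cyclicShift n v)) * e₀ n := by
  ext <;> simp [e₀]

lemma e₀_pow : e₀ n ^ n = eTop n := by
  simp only [e₀, eTop]
  rw [← map_pow, ← ofAdd_nsmul]
  simp

lemma cyclicShift_iterate_self (v : Fin n → ℤ) : (cyclicShift n)^[n] v = v := by
  have h (m : ℕ) (j : Fin n) : (cyclicShift n)^[m] v j = v (j - Fin.ofNat n m) := by
    induction m generalizing j with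
    | zero => simp
    | succ m ih =>
      rw [Function.iterate_succ_apply']
      change (cyclicShift n)^[m] v (j - 1) = _
      rw [ih, show Fin.ofNat n (m + 1) = 1 + Fin.ofNat n m by
        ext; simp [Fin.val_add, add_comm], sub_sub]
  funext j
  rw [h, show Fin.ofNat n n = 0 by ext; simp, sub_zero]

lemma commute_eTop (g : AgeevGroup n) : Commute (eTop n) g := by
  have hinl (m : ℕ) (v : Fin n → ℤ) :
      e₀ n ^ m * SemidirectProduct.inl (Multiplicative.ofAdd v) =
        SemidirectProduct.inl (Multiplicative.ofAdd ((cyclicShift n)^[m] v)) * e₀ n ^ m := by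
    induction m with
    | zero => simp
    | succ m ih =>
      rw [pow_succ', mul_assoc, ih, ← mul_assoc, e₀_mul_inl, mul_assoc,
        Function.iterate_succ_apply']
  rw [← SemidirectProduct.inl_left_mul_inr_right g]
  refine Commute.mul_right ?_ ?_
  · have := hinl n (Multiplicative.toAdd g.left)
    rwa [cyclicShift_iterate_self, e₀_pow] at this
  · exact (Commute.all (Multiplicative.ofAdd (n : ℤ)) g.right).map SemidirectProduct.inr

lemma eDiff_mul_inl (r : Fin n) :
    eDiff n r * SemidirectProduct.inl (Multiplicative.ofAdd (Pi.single r 1)) =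
      SemidirectProduct.inl (Multiplicative.ofAdd (Pi.single 0 1)) := by
  rw [eDiff, ← map_mul, ← ofAdd_add, sub_add_cancel]

lemma countable_ageevGroup : Countable (AgeevGroup n) :=
  have : Countable (Multiplicative (Fin n → ℤ)) := inferInstanceAs (Countable (Fin n → ℤ))
  have : Countable (Multiplicative ℤ) := inferInstanceAs (Countable ℤ)
  (SemidirectProduct.equivProd : AgeevGroup n ≃ _).injective.countable

/-- A finite-dimensional representation of `ℤⁿ ⋊ ℤ` in which no `e₁ - Lʳ e₁` has a nonzero fixed
vector has dimension divisible by `n`. -/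
theorem dvd_finrank_of_representation {K : Type*} [AddCommGroup K] [Module ℂ K]
    [FiniteDimensional ℂ K] (ρ : AgeevGroup n →* End ℂ K)
    (hfix : ∀ r : Fin n, r ≠ 0 → ∀ v : K, ρ (eDiff n r) v = v → v = 0) :
    n ∣ finrank ℂ K := by
  let a : Fin n → AgeevGroup n := fun i =>
    SemidirectProduct.inl (Multiplicative.ofAdd (Pi.single i 1))
  have hunit (g : AgeevGroup n) (v : K) : ρ g⁻¹ (ρ g v) = v := by
    rw [← Module.End.mul_apply, ← map_mul]; simp
  have hunit' (g : AgeevGroup n) (v : K) : ρ g (ρ g⁻¹ v) = v := by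
    rw [← Module.End.mul_apply, ← map_mul]; simp
  let w : K ≃ₗ[ℂ] K := LinearEquiv.ofLinearMap (ρ (e₀ n)) (ρ (e₀ n)⁻¹)
    (LinearMap.ext (hunit' _)) (LinearMap.ext (hunit _))
  have hw (i : Fin n) (v : K) : w (ρ (a i) v) = ρ (a (i + 1)) (w v) := by
    change (ρ (e₀ n) * ρ (a i)) v = (ρ (a (i + 1)) * ρ (e₀ n)) v
    rw [← map_mul, ← map_mul, e₀_mul_inl, cyclicShift_single]
  refine dvd_finrank_of_cyclic_conjugation (fun i => ρ (a i)) (fun i j => ?_) w hw fun i => ?_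
  · exact ((Commute.all _ _).map SemidirectProduct.inl).map ρ
  induction i using Fin.add_one_induction with
  | zero =>
    intro r hr v hv
    have h0 : ρ (a r) v = 0 := by
      refine hfix r hr.symm _ ?_
      rw [← Module.End.mul_apply, ← map_mul, eDiff_mul_inl, ← hv]
    simpa [h0] using (hunit (a r) v).symm
  | step i ih =>
    intro j hj v hv
    obtain ⟨u, rfl⟩ := w.surjective v
    obtain ⟨j, rfl⟩ : ∃ l, j = l + 1 := ⟨j - 1, by simp⟩
    rw [← hw, ← hw, w.injective.eq_iff] at hv
    rw [ih j (by rintro rfl; exact hj rfl) u hv, map_zero]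

end AgeevGroup

section Analysis

open Filter Topology InnerProductSpace

/-- An integrable function on the circle with vanishing Fourier coefficients (with respect to an
arbitrary measure) vanishes almost everywhere. -/
lemma ae_eq_zero_of_forall_integral_fourier_mul_eq_zero {μ : Measure (AddCircle (1 : ℝ))}
    {h : AddCircle (1 : ℝ) → ℂ} (hh : Integrable h μ)
    (h0 : ∀ m : ℤ, ∫ χ, fourier m χ * h χ ∂μ = 0) : h =ᵐ[μ] 0 := by
  have hinteg (f : C(AddCircle (1 : ℝ), ℂ)) : Integrable (fun χ => f χ * h χ) μ :=
    hh.bdd_mul f.continuous.aestronglyMeasurable (ae_of_all _ fun χ => f.norm_coe_le_norm χ)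
  let Λ : C(AddCircle (1 : ℝ), ℂ) →L[ℂ] ℂ := LinearMap.mkContinuous
    { toFun := fun f => ∫ χ, f χ * h χ ∂μ
      map_add' := fun f g => by
        simp only [ContinuousMap.add_apply, add_mul]
        exact integral_add (hinteg f) (hinteg g)
      map_smul' := fun c f => by
        simp only [ContinuousMap.smul_apply, smul_eq_mul, mul_assoc, RingHom.id_apply]
        exact integral_const_mul c _ } (∫ χ, ‖h χ‖ ∂μ) (fun f => by
      simp only [LinearMap.coe_mk, AddHom.coe_mk]
      rw [← integral_mul_const]
      refine norm_integral_le_of_norm_le (hh.norm.mul_const _) (ae_of_all _ fun χ => ?_)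
      rw [norm_mul, mul_comm]
      gcongr
      exact f.norm_coe_le_norm χ)
  have hΛ (f : C(AddCircle (1 : ℝ), ℂ)) : ∫ χ, f χ * h χ ∂μ = 0 := by
    have hle : (Submodule.span ℂ (Set.range (@fourier (1 : ℝ)))).topologicalClosure ≤
        LinearMap.ker (Λ : C(AddCircle (1 : ℝ), ℂ) →ₗ[ℂ] ℂ) := by
      refine Submodule.topologicalClosure_minimal _ ?_ Λ.isClosed_ker
      rw [Submodule.span_le]
      rintro _ ⟨m, rfl⟩
      exact h0 m
    rw [span_fourier_closure_eq_top] at hle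
    exact hle (Submodule.mem_top : f ∈ ⊤)
  refine ae_eq_zero_of_forall_setIntegral_isClosed_eq_zero hh fun F hF => ?_
  rw [← integral_indicator hF.measurableSet]
  have hlim : Tendsto (fun k : ℕ => ∫ χ, ((hF.apprSeq k χ : ℝ) : ℂ) * h χ ∂μ) atTop
      (𝓝 (∫ χ, F.indicator h χ ∂μ)) := by
    refine tendsto_integral_of_dominated_convergence (fun χ => ‖h χ‖) (fun k => ?_) hh.norm
      (fun k => ae_of_all _ fun χ => ?_) (ae_of_all _ fun χ => ?_)
    · exact (hinteg ⟨fun χ => ((hF.apprSeq k χ : ℝ) : ℂ), by fun_prop⟩).aestronglyMeasurable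
    · rw [norm_mul]
      refine mul_le_of_le_one_left (norm_nonneg _) ?_
      have := HasOuterApproxClosed.apprSeq_apply_le_one hF k χ
      simpa using this
    · have := tendsto_pi_nhds.mp (HasOuterApproxClosed.tendsto_apprSeq hF) χ
      have h2 : Tendsto (fun k => ((hF.apprSeq k χ : ℝ) : ℂ)) atTop
          (𝓝 (((F.indicator (fun _ => (1 : NNReal)) χ : NNReal) : ℝ) : ℂ)) :=
        ((Complex.continuous_ofReal.comp NNReal.continuous_coe).tendsto _).comp this
      convert h2.mul_const (h χ) using 2
      by_cases hχ : χ ∈ F <;> simp [hχ]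
  refine tendsto_nhds_unique hlim (tendsto_const_nhds.congr fun k => ?_)
  exact (hΛ ⟨fun χ => ((hF.apprSeq k χ : ℝ) : ℂ), by fun_prop⟩).symm

/-- Two families with the same Gram matrix, the first one total, are related by a map preserving
inner products. -/
lemma exists_isometry_of_gram_eq {ι E F : Type*} [NormedAddCommGroup E] [InnerProductSpace ℂ E]
    [NormedAddCommGroup F] [InnerProductSpace ℂ F] [CompleteSpace F] (v : ι → E) (w : ι → F)
    (hv : (Submodule.span ℂ (Set.range v)).topologicalClosure = ⊤)
    (hvw : ∀ i j, inner ℂ (w i) (w j) = inner ℂ (v i) (v j)) :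
    ∃ Φ : E →ₗᵢ[ℂ] F, ∀ i, Φ (v i) = w i := by
  have hinner (a : ι →₀ ℂ) : ‖Finsupp.linearCombination ℂ w a‖ =
      ‖Finsupp.linearCombination ℂ v a‖ := by
    rw [@norm_eq_sqrt_re_inner ℂ, @norm_eq_sqrt_re_inner ℂ]
    simp only [Finsupp.linearCombination_apply, Finsupp.sum_inner, Finsupp.inner_sum, inner_smul_left,
      inner_smul_right, hvw]
  have hdense : DenseRange (Finsupp.linearCombination ℂ v) := by
    rw [DenseRange, ← LinearMap.coe_range, Finsupp.range_linearCombination]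
    exact Submodule.dense_iff_topologicalClosure_eq_top.mpr hv
  have hext := LinearMap.extendOfNorm_eq (f := Finsupp.linearCombination ℂ w) hdense
    ⟨1, fun a => by rw [hinner, one_mul]⟩
  let Φ := (Finsupp.linearCombination ℂ w).extendOfNorm (Finsupp.linearCombination ℂ v)
  refine ⟨⟨Φ, fun u => ?_⟩, fun i => ?_⟩
  · refine hdense.induction_on (p := fun u => ‖Φ u‖ = ‖u‖) u
      (isClosed_eq (by fun_prop) (by fun_prop)) fun a => ?_
    simp only [Φ, hext, hinner]
  · have := hext (Finsupp.single i 1)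
    simpa using this

/-- A vector in the closure of `D` is approximated by a sequence in `D` whose images under two
continuous maps into `Lᵖ` converge almost everywhere. -/
lemma exists_seq_tendsto_ae {X E F : Type*} [MeasurableSpace X] {μ : Measure X}
    [TopologicalSpace F] [FrechetUrysohnSpace F]
    [NormedAddCommGroup E] {f g : F → Lp E 2 μ} (hf : Continuous f) (hg : Continuous g)
    {D : Set F} {u : F} (hu : u ∈ closure D) :
    ∃ d : ℕ → F, (∀ k, d k ∈ D) ∧
      (∀ᵐ χ ∂μ, Tendsto (fun k => f (d k) χ) atTop (𝓝 (f u χ))) ∧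
      ∀ᵐ χ ∂μ, Tendsto (fun k => g (d k) χ) atTop (𝓝 (g u χ)) := by
  obtain ⟨d, hd, hlim⟩ := mem_closure_iff_seq_limit.mp hu
  obtain ⟨k, hk, hfk⟩ := (tendstoInMeasure_of_tendsto_Lp
    ((hf.tendsto u).comp hlim)).exists_seq_tendsto_ae
  obtain ⟨l, hl, hgl⟩ := (tendstoInMeasure_of_tendsto_Lp
    ((hg.tendsto u).comp (hlim.comp hk.tendsto_atTop))).exists_seq_tendsto_ae
  refine ⟨fun j => d (k (l j)), fun j => hd _, ?_, hgl⟩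
  filter_upwards [hfk] with χ hχ using hχ.comp hl.tendsto_atTop

end Analysis

section SpectralModel

set_option linter.unusedSectionVars false

open Filter Topology InnerProductSpace

/-- The square root of the density `dσᵢ/dσ₀`. -/
noncomputable def sqrtDensity (σ : ℕ → Measure (AddCircle (1 : ℝ))) (i : ℕ)
    (χ : AddCircle (1 : ℝ)) : ℂ :=
  (√((σ i).rnDeriv (σ 0) χ).toReal : ℝ)

/-- A realisation of the Hilbert space inside `L²(σ₀; ℓ²)`, in which `V` acts as multiplication by
a character and `x i` becomes the section `√(dσᵢ/dσ₀) eᵢ`. -/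
structure IsSpectralModel (V : H ≃ₗᵢ[ℂ] H) (x : ℕ → H) (σ : ℕ → Measure (AddCircle (1 : ℝ)))
    (Φ : H →ₗᵢ[ℂ] Lp (lp (fun _ : ℕ => ℂ) 2) 2 (σ 0)) : Prop where
  apply_generator : ∀ i, ∀ᵐ χ ∂(σ 0), Φ (x i) χ = sqrtDensity σ i χ • lp.single 2 i (1 : ℂ)
  apply_zpow : ∀ u, ∀ m : ℤ, ∀ᵐ χ ∂(σ 0), Φ ((V ^ m) u) χ = fourier (-m) χ • Φ u χ
  apply_eq_zero : ∀ u i, ∀ᵐ χ ∂(σ 0), sqrtDensity σ i χ = 0 → Φ u χ i = 0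

lemma measurable_sqrtDensity (σ : ℕ → Measure (AddCircle (1 : ℝ))) (i : ℕ) :
    Measurable (sqrtDensity σ i) := by
  unfold sqrtDensity
  fun_prop

lemma norm_sqrtDensity_sq (σ : ℕ → Measure (AddCircle (1 : ℝ))) (i : ℕ)
    (χ : AddCircle (1 : ℝ)) :
    ‖sqrtDensity σ i χ‖ ^ 2 = ((σ i).rnDeriv (σ 0) χ).toReal := by
  simp [sqrtDensity, Real.sq_sqrt]

lemma IsSpectralDecompositionZ.absolutelyContinuous {V : H ≃ₗᵢ[ℂ] H} {x : ℕ → H}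
    {σ : ℕ → Measure (AddCircle (1 : ℝ))} (h : IsSpectralDecompositionZ V x σ) (i : ℕ) :
    σ i ≪ σ 0 := by
  induction i with
  | zero => exact Measure.AbsolutelyContinuous.rfl
  | succ i ih => exact (h.chain i).trans ih

lemma zpow_apply_mem_zCyclicSpace (V : H ≃ₗᵢ[ℂ] H) (x : H) (m : ℤ) :
    (V ^ m) x ∈ zCyclicSpace V x :=
  Submodule.subset_span ⟨m, rfl⟩

lemma zpow_add_apply (V : H ≃ₗᵢ[ℂ] H) (m l : ℤ) (u : H) :
    (V ^ (m + l)) u = (V ^ m) ((V ^ l) u) := by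
  rw [zpow_add]
  rfl

lemma inner_zpow_zpow (V : H ≃ₗᵢ[ℂ] H) (u v : H) (m l : ℤ) :
    inner ℂ ((V ^ m) u) ((V ^ l) v) = inner ℂ ((V ^ (m - l)) u) v := by
  rw [← (V ^ l).inner_map_map ((V ^ (m - l)) u) v, ← zpow_add_apply,
    add_sub_cancel]

/-- The translates of the generators span a dense subspace. -/
lemma IsSpectralDecompositionZ.span_eq_top {V : H ≃ₗᵢ[ℂ] H} {x : ℕ → H}
    {σ : ℕ → Measure (AddCircle (1 : ℝ))} (h : IsSpectralDecompositionZ V x σ) :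
    (Submodule.span ℂ (Set.range fun p : ℕ × ℤ => (V ^ p.2) (x p.1))).topologicalClosure = ⊤ := by
  rw [eq_top_iff, ← h.total]
  refine Submodule.topologicalClosure_mono (iSup_le fun i => Submodule.span_mono ?_)
  rintro _ ⟨m, rfl⟩
  exact ⟨(i, m), rfl⟩

lemma IsSpectralDecompositionZ.exists_isSpectralModel {V : H ≃ₗᵢ[ℂ] H} {x : ℕ → H}
    {σ : ℕ → Measure (AddCircle (1 : ℝ))} (h : IsSpectralDecompositionZ V x σ) :
    ∃ Φ : H →ₗᵢ[ℂ] Lp (lp (fun _ : ℕ => ℂ) 2) 2 (σ 0), IsSpectralModel V x σ Φ := by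
  let e : ℕ → lp (fun _ : ℕ => ℂ) 2 := fun i => lp.single 2 i (1 : ℂ)
  have he (i j : ℕ) : inner ℂ (e i) (e j) = if i = j then (1 : ℂ) else 0 := by
    simp only [e, lp.inner_single_left]
    by_cases hij : i = j <;> simp [hij, lp.single_apply]
  let w : ℕ × ℤ → AddCircle (1 : ℝ) → lp (fun _ : ℕ => ℂ) 2 := fun p χ =>
    (fourier (-p.2) χ * sqrtDensity σ p.1 χ) • e p.1
  have hw (p : ℕ × ℤ) : MemLp (w p) 2 (σ 0) := by
    have hmeas : AEStronglyMeasurable (w p) (σ 0) := by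
      refine AEStronglyMeasurable.smul_const ?_ _
      exact ((fourier (-p.2)).continuous.measurable.mul
        (measurable_sqrtDensity σ p.1)).aestronglyMeasurable
    have := h.finite p.1
    rw [memLp_two_iff_integrable_sq_norm hmeas]
    refine (Measure.integrable_toReal_rnDeriv (μ := σ p.1) (ν := σ 0)).congr
      (ae_of_all _ fun χ => ?_)
    have hnorm : ‖e p.1‖ = 1 := by simp [e, lp.norm_single]
    simp only [w, norm_smul, norm_mul, hnorm, mul_one, fourier_apply, Circle.norm_coe, one_mul]
    exact (norm_sqrtDensity_sq σ p.1 χ).symm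
  obtain ⟨Φ, hΦ⟩ := exists_isometry_of_gram_eq (fun p : ℕ × ℤ => (V ^ p.2) (x p.1))
    (fun p => (hw p).toLp) h.span_eq_top (by
      rintro ⟨i, m⟩ ⟨j, l⟩
      rw [L2.inner_def]
      have hae : (fun χ => inner ℂ ((hw (i, m)).toLp (w (i, m)) χ) ((hw (j, l)).toLp (w (j, l)) χ)) =ᵐ[σ 0]
          fun χ => inner ℂ (w (i, m) χ) (w (j, l) χ) := by
        filter_upwards [(hw (i, m)).coeFn_toLp, (hw (j, l)).coeFn_toLp] with χ h1 h2
        rw [h1, h2]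
      rw [integral_congr_ae hae]
      simp only [w, inner_smul_left, inner_smul_right, he]
      by_cases hij : i = j
      · subst hij
        have := h.finite i
        have := h.finite 0
        have := Measure.haveLebesgueDecomposition_of_sigmaFinite (σ i) (σ 0)
        rw [inner_zpow_zpow, h.spectral,
          ← integral_rnDeriv_smul (h.absolutelyContinuous i)]
        refine integral_congr_ae (ae_of_all _ fun χ => ?_)
        have hs : (starRingEnd ℂ) (sqrtDensity σ i χ) * sqrtDensity σ i χ =
            (((σ i).rnDeriv (σ 0) χ).toReal : ℂ) := by
          rw [mul_comm, Complex.mul_conj, Complex.normSq_eq_norm_sq, norm_sqrtDensity_sq]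
        have hf : (starRingEnd ℂ) (fourier (-m) χ) * fourier (-l) χ = fourier (m - l) χ := by
          rw [fourier_neg, RCLike.conj_conj, sub_eq_add_neg, fourier_add]
        simp only [if_true, mul_one, map_mul, Complex.real_smul]
        rw [← hs, ← hf]
        ring
      · simp only [hij, if_false, mul_zero, integral_zero]
        exact (h.orthogonal i j hij _ (zpow_apply_mem_zCyclicSpace V _ m) _
          (zpow_apply_mem_zCyclicSpace V _ l)).symm)
  have hgen (i : ℕ) (m : ℤ) : ∀ᵐ χ ∂(σ 0), Φ ((V ^ m) (x i)) χ = w (i, m) χ := by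
    rw [hΦ (i, m)]
    exact (hw (i, m)).coeFn_toLp
  have hgen0 (i : ℕ) : ∀ᵐ χ ∂(σ 0), Φ (x i) χ = sqrtDensity σ i χ • e i := by
    filter_upwards [hgen i 0] with χ hχ
    simpa [w] using hχ
  refine ⟨Φ, hgen0, fun u m => ?_, fun u i => ?_⟩
  · let S : Submodule ℂ H :=
      { carrier := {u | ∀ᵐ χ ∂(σ 0), Φ ((V ^ m) u) χ = fourier (-m) χ • Φ u χ}
        zero_mem' := by
          simp only [Set.mem_ofPred_eq, map_zero]
          filter_upwards [Lp.coeFn_zero (lp (fun _ : ℕ => ℂ) 2) 2 (σ 0)] with χ hχ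
          rw [hχ]; simp
        add_mem' := fun {a b} ha hb => by
          simp only [Set.mem_ofPred_eq, map_add] at ha hb ⊢
          filter_upwards [ha, hb, Lp.coeFn_add (Φ ((V ^ m) a)) (Φ ((V ^ m) b)),
            Lp.coeFn_add (Φ a) (Φ b)] with χ h1 h2 h3 h4
          rw [h3, h4, Pi.add_apply, Pi.add_apply, h1, h2, smul_add]
        smul_mem' := fun c a ha => by
          simp only [Set.mem_ofPred_eq, map_smul] at ha ⊢
          filter_upwards [ha, Lp.coeFn_smul c (Φ ((V ^ m) a)), Lp.coeFn_smul c (Φ a)]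
            with χ h1 h2 h3
          rw [h2, h3, Pi.smul_apply, Pi.smul_apply, h1, smul_comm] }
    have hS : Submodule.span ℂ (Set.range fun p : ℕ × ℤ => (V ^ p.2) (x p.1)) ≤ S := by
      rw [Submodule.span_le]
      rintro _ ⟨⟨i, l⟩, rfl⟩
      change ∀ᵐ χ ∂(σ 0), _
      simp only [← zpow_add_apply]
      filter_upwards [hgen i (m + l), hgen i l] with χ h1 h2
      rw [h1, h2]
      simp only [w, smul_smul, neg_add, fourier_add, mul_assoc]
    have hcl : u ∈ closure (S : Set H) := by
      have := Submodule.topologicalClosure_mono hS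
      rw [h.span_eq_top] at this
      exact this Submodule.mem_top
    obtain ⟨d, hd, h1, h2⟩ := exists_seq_tendsto_ae Φ.continuous
      (Φ.continuous.comp (V ^ m).continuous) hcl
    filter_upwards [h1, h2, ae_all_iff.mpr hd] with χ h1 h2 h3
    refine tendsto_nhds_unique h2 ?_
    simp only [Function.comp_apply, h3]
    exact h1.const_smul _
  · let S : Submodule ℂ H :=
      { carrier := {u | ∀ᵐ χ ∂(σ 0), sqrtDensity σ i χ = 0 → Φ u χ i = 0}
        zero_mem' := by
          simp only [Set.mem_ofPred_eq, map_zero]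
          filter_upwards [Lp.coeFn_zero (lp (fun _ : ℕ => ℂ) 2) 2 (σ 0)] with χ hχ
          rw [hχ]; simp
        add_mem' := fun {a b} ha hb => by
          simp only [Set.mem_ofPred_eq, map_add] at ha hb ⊢
          filter_upwards [ha, hb, Lp.coeFn_add (Φ a) (Φ b)] with χ h1 h2 h3 h0
          rw [h3, Pi.add_apply, lp.coeFn_add, Pi.add_apply, h1 h0, h2 h0, add_zero]
        smul_mem' := fun c a ha => by
          simp only [Set.mem_ofPred_eq, map_smul] at ha ⊢
          filter_upwards [ha, Lp.coeFn_smul c (Φ a)] with χ h1 h2 h0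
          rw [h2, Pi.smul_apply, lp.coeFn_smul, Pi.smul_apply, h1 h0, smul_zero] }
    have hS : Submodule.span ℂ (Set.range fun p : ℕ × ℤ => (V ^ p.2) (x p.1)) ≤ S := by
      rw [Submodule.span_le]
      rintro _ ⟨⟨j, l⟩, rfl⟩
      change ∀ᵐ χ ∂(σ 0), _
      filter_upwards [hgen j l] with χ h1 h0
      rw [h1]
      by_cases hij : i = j
      · subst hij; simp [w, h0]
      · simp [w, e, lp.single_apply, hij]
    have hcl : u ∈ closure (S : Set H) := by
      have := Submodule.topologicalClosure_mono hS
      rw [h.span_eq_top] at this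
      exact this Submodule.mem_top
    obtain ⟨d, hd, h1, -⟩ := exists_seq_tendsto_ae Φ.continuous Φ.continuous hcl
    filter_upwards [h1, ae_all_iff.mpr hd] with χ h1 h3 h0
    have hcoord : Tendsto (fun k => Φ (d k) χ i) atTop (𝓝 (Φ u χ i)) :=
      ((lp.evalCLM ℂ (fun _ : ℕ => ℂ) 2 i).continuous.tendsto _).comp h1
    simpa [h3 _ h0, eq_comm] using hcoord

end SpectralModel

section Fibers

open Filter Topology InnerProductSpace

set_option linter.unusedSectionVars false

lemma IsSpectralModel.inner_apply_symm {V : H ≃ₗᵢ[ℂ] H} {x : ℕ → H}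
    {σ : ℕ → Measure (AddCircle (1 : ℝ))} {Φ : H →ₗᵢ[ℂ] Lp (lp (fun _ : ℕ => ℂ) 2) 2 (σ 0)}
    (hΦ : IsSpectralModel V x σ Φ) {T : H ≃ₗᵢ[ℂ] H} (hT : Commute V T) (u v : H) :
    ∀ᵐ χ ∂(σ 0), inner ℂ (Φ (T⁻¹ u) χ) (Φ v χ) = inner ℂ (Φ u χ) (Φ (T v) χ) := by
  have hinteg := (L2.integrable_inner (𝕜 := ℂ) (Φ (T⁻¹ u)) (Φ v)).sub
    (L2.integrable_inner (𝕜 := ℂ) (Φ u) (Φ (T v)))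
  have hfourier (a b : H) (m : ℤ) :
      Integrable (fun χ => fourier m χ * inner ℂ (Φ a χ) (Φ b χ)) (σ 0) ∧
      ∫ χ, fourier m χ * inner ℂ (Φ a χ) (Φ b χ) ∂(σ 0) = inner ℂ a ((V ^ (-m)) b) := by
    have hae : (fun χ => inner ℂ (Φ a χ) (Φ ((V ^ (-m)) b) χ)) =ᵐ[σ 0]
        fun χ => fourier m χ * inner ℂ (Φ a χ) (Φ b χ) := by
      filter_upwards [hΦ.apply_zpow b (-m)] with χ hχ
      rw [hχ, neg_neg, inner_smul_right]
    refine ⟨(L2.integrable_inner _ _).congr hae, ?_⟩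
    rw [← integral_congr_ae hae, ← L2.inner_def, Φ.inner_map_map]
  have hzero := ae_eq_zero_of_forall_integral_fourier_mul_eq_zero hinteg fun m => by
    simp only [Pi.sub_apply, mul_sub]
    rw [integral_sub (hfourier _ _ m).1 (hfourier _ _ m).1, (hfourier _ _ m).2,
      (hfourier _ _ m).2, sub_eq_zero, ← T.inner_map_map (T⁻¹ u)]
    have h1 : T (T⁻¹ u) = u := T.apply_symm_apply u
    have h2 : T ((V ^ (-m)) v) = (V ^ (-m)) (T v) :=
      DFunLike.congr_fun (hT.zpow_left (-m)).eq.symm v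
    rw [h1, h2]
  filter_upwards [hzero] with χ hχ
  exact sub_eq_zero.mp hχ

/-- Suppose that the matrices `B g` describe the action of `G` on the values `F` of vectors in a
finite-dimensional fiber `ℂˢ`, that `F (x i)` is a nonzero multiple of the `i`-th coordinate vector,
and that `F (x i)` is a limit of vectors in the range of `B (e₁ - Lʳ e₁) - 1` for every `r ≠ 0`.
Then `n` divides the dimension of the fiber. -/
lemma dvd_card_of_fiber {n : ℕ} [NeZero n] (U : AgeevGroup n →* (H ≃ₗᵢ[ℂ] H)) (S : Finset ℕ)
    (x : S → H) (s : S → ℂ) (hs : ∀ i, s i ≠ 0) (F : H → S → ℂ)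
    (hx : ∀ i, F (x i) = s i • Pi.single i 1) (B : AgeevGroup n → Matrix S S ℂ)
    (hB : ∀ g g' j, F (U g (U g' (x j))) = (B g).mulVec (F (U g' (x j))))
    (hfix : ∀ r : Fin n, r ≠ 0 → ∀ j, ∃ y : ℕ → S → ℂ,
      Tendsto (fun k => (B (eDiff n r)).mulVec (y k) - y k) atTop (𝓝 (F (x j)))) :
    n ∣ S.card := by
  have hcol (g : AgeevGroup n) (j : S) :
      F (U g (x j)) = s j • (B g).mulVec (Pi.single j 1) := by
    have := hB g 1 j
    rw [map_one] at this
    change F (U g (x j)) = (B g).mulVec (F (x j)) at this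
    rw [this, hx, Matrix.mulVec_smul]
  have hext (M N : Matrix S S ℂ)
      (h : ∀ j, s j • M.mulVec (Pi.single j 1) = s j • N.mulVec (Pi.single j 1)) : M = N := by
    refine Matrix.ext_of_mulVec_single fun j => ?_
    exact smul_right_injective _ (hs j) (h j)
  let ρ : AgeevGroup n →* End ℂ (S → ℂ) :=
    { toFun := fun g => Matrix.toLin' (B g)
      map_one' := by
        refine Eq.trans (congrArg _ ?_) Matrix.toLin'_one
        refine hext _ _ fun j => ?_
        rw [← hcol, map_one, Matrix.one_mulVec]
        exact hx j
      map_mul' := fun g g' => by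
        rw [Module.End.mul_eq_comp, ← Matrix.toLin'_mul]
        congr 1
        refine hext _ _ fun j => ?_
        rw [← hcol, ← Matrix.mulVec_mulVec, ← Matrix.mulVec_smul, ← hcol, map_mul]
        exact hB g g' j }
  rw [← Fintype.card_coe, ← Module.finrank_fintype_fun_eq_card ℂ]
  refine dvd_finrank_of_representation ρ fun r hr v hv => ?_
  let δ : End ℂ (S → ℂ) := ρ (eDiff n r) - 1
  have hsurj : Function.Surjective δ := by
    rw [← LinearMap.range_eq_top, eq_top_iff, ← (Pi.basisFun ℂ S).span_eq, Submodule.span_le]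
    rintro _ ⟨j, rfl⟩
    obtain ⟨y, hy⟩ := hfix r hr j
    have hmem : F (x j) ∈ LinearMap.range δ :=
      (Submodule.closed_of_finiteDimensional _).mem_of_tendsto hy
        (Eventually.of_forall fun k => ⟨y k, rfl⟩)
    rw [hx, Submodule.smul_mem_iff _ (hs j)] at hmem
    simpa using hmem
  have hinj := LinearMap.injective_iff_surjective.mpr hsurj
  exact hinj (by simp [δ, hv])

/-- A unitary operator without nonzero fixed vectors: `T - 1` has dense range. -/
lemma dense_range_sub_self {T : H ≃ₗᵢ[ℂ] H} (hT : ∀ u, T u = u → u = 0) :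
    Dense (Set.range fun u => T u - u) := by
  let f : H →ₗ[ℂ] H := (T.toLinearEquiv : H →ₗ[ℂ] H) - LinearMap.id
  change Dense (LinearMap.range f : Set H)
  rw [Submodule.dense_iff_topologicalClosure_eq_top,
    Submodule.topologicalClosure_eq_top_iff, Submodule.eq_bot_iff]
  intro v hv
  rw [Submodule.mem_orthogonal] at hv
  refine hT v ?_
  have h (u : H) : inner ℂ (T u) v = inner ℂ u v := by
    have := hv (f u) ⟨u, rfl⟩
    simpa [f, inner_sub_left, sub_eq_zero] using this
  refine ext_inner_left ℂ fun u => ?_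
  obtain ⟨u, rfl⟩ := T.surjective u
  rw [T.inner_map_map, h]

/-- The set of coordinates that are present in the fiber over `χ`. -/
def fiberSupport (σ : ℕ → Measure (AddCircle (1 : ℝ))) (χ : AddCircle (1 : ℝ)) : Set ℕ :=
  {i | sqrtDensity σ i χ ≠ 0}

lemma multiplicityFun_eq_tsum_fiberSupport {σ : ℕ → Measure (AddCircle (1 : ℝ))}
    (hσ : ∀ i, IsFiniteMeasure (σ i)) :
    ∀ᵐ χ ∂(σ 0), multiplicityFun σ χ = ∑' _ : fiberSupport σ χ, (1 : ℝ≥0∞) := by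
  have htop (i : ℕ) : ∀ᵐ χ ∂(σ 0), (σ i).rnDeriv (σ 0) χ ≠ ∞ := by
    have := hσ i
    filter_upwards [Measure.rnDeriv_lt_top (σ i) (σ 0)] with χ hχ using hχ.ne
  filter_upwards [ae_all_iff.mpr htop] with χ hχ
  rw [tsum_subtype (fiberSupport σ χ) fun _ => (1 : ℝ≥0∞)]
  refine tsum_congr fun i => ?_
  have : i ∈ fiberSupport σ χ ↔ (σ i).rnDeriv (σ 0) χ ≠ 0 := by
    simp [fiberSupport, sqrtDensity, ENNReal.toReal_eq_zero_iff, hχ i]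
  simp [Set.indicator, this]

lemma tsum_one_eq_card (S : Finset ℕ) : ∑' _ : (S : Set ℕ), (1 : ℝ≥0∞) = S.card := by
  simp

lemma IsSpectralModel.ae_dvd_card {n : ℕ} [NeZero n] {U : AgeevGroup n →* (H ≃ₗᵢ[ℂ] H)}
    (hfix : ∀ r : Fin n, r ≠ 0 → ∀ u : H, U (eDiff n r) u = u → u = 0) {x : ℕ → H}
    {σ : ℕ → Measure (AddCircle (1 : ℝ))} {Φ : H →ₗᵢ[ℂ] Lp (lp (fun _ : ℕ => ℂ) 2) 2 (σ 0)}
    (hΦ : IsSpectralModel (U (eTop n)) x σ Φ) :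
    ∀ᵐ χ ∂(σ 0), ∀ S : Finset ℕ, (S : Set ℕ) = fiberSupport σ χ → n ∣ S.card := by
  have := countable_ageevGroup (n := n)
  have hseq (r : Fin n) (hr : r ≠ 0) (j : ℕ) : ∃ d : ℕ → H, ∀ᵐ χ ∂(σ 0),
      Tendsto (fun k => Φ (U (eDiff n r) (d k)) χ - Φ (d k) χ) atTop (𝓝 (Φ (x j) χ)) := by
    obtain ⟨y, hy, hlim, -⟩ := exists_seq_tendsto_ae Φ.continuous Φ.continuous
      (dense_range_sub_self (hfix r hr) (x j))
    choose d hd using hy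
    refine ⟨d, ?_⟩
    have hsub (k : ℕ) : ∀ᵐ χ ∂(σ 0),
        Φ (y k) χ = Φ (U (eDiff n r) (d k)) χ - Φ (d k) χ := by
      rw [← hd k, map_sub]
      exact Lp.coeFn_sub _ _
    filter_upwards [hlim, ae_all_iff.mpr hsub] with χ hχ hχ'
    simpa only [hχ'] using hχ
  choose! d hd using hseq
  have hsymm (g : AgeevGroup n) (i : ℕ) (u : H) : ∀ᵐ χ ∂(σ 0),
      inner ℂ (Φ (U g⁻¹ (x i)) χ) (Φ u χ) = inner ℂ (Φ (x i) χ) (Φ (U g u) χ) := by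
    rw [map_inv]
    exact hΦ.inner_apply_symm ((commute_eTop g).map U) _ _
  have hlim (r : Fin n) (j : ℕ) : ∀ᵐ χ ∂(σ 0), r ≠ 0 →
      Tendsto (fun k => Φ (U (eDiff n r) (d r j k)) χ - Φ (d r j k) χ) atTop (𝓝 (Φ (x j) χ)) := by
    by_cases hr : r = 0
    · simp [hr]
    · filter_upwards [hd r hr j] with χ hχ _ using hχ
  filter_upwards [ae_all_iff.mpr hΦ.apply_generator,
    ae_all_iff.mpr fun r => ae_all_iff.mpr (hlim r),
    ae_all_iff.mpr fun g => ae_all_iff.mpr fun g' => ae_all_iff.mpr fun i => ae_all_iff.mpr fun j =>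
      hsymm g i (U g' (x j)),
    ae_all_iff.mpr fun g => ae_all_iff.mpr fun i => ae_all_iff.mpr fun r => ae_all_iff.mpr fun j =>
      ae_all_iff.mpr fun k => hsymm g i (d r j k),
    ae_all_iff.mpr fun g => ae_all_iff.mpr fun i => ae_all_iff.mpr fun l =>
      hΦ.apply_eq_zero (U g (x i)) l] with χ hgen hlim hsymm hsymm' hzero S hS
  have hmemS (i : ℕ) : i ∈ S ↔ sqrtDensity σ i χ ≠ 0 := by
    rw [← Finset.mem_coe, hS]
    rfl
  let F : H → S → ℂ := fun u i => Φ u χ i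
  let B : AgeevGroup n → Matrix S S ℂ := fun g i l =>
    (starRingEnd ℂ) (Φ (U g⁻¹ (x i)) χ l) / sqrtDensity σ i χ
  have hconj (i : ℕ) : (starRingEnd ℂ) (sqrtDensity σ i χ) = sqrtDensity σ i χ :=
    Complex.conj_ofReal _
  have hB (g : AgeevGroup n) (u : H)
      (hu : ∀ i, inner ℂ (Φ (U g⁻¹ (x i)) χ) (Φ u χ) = inner ℂ (Φ (x i) χ) (Φ (U g u) χ)) :
      F (U g u) = (B g).mulVec (F u) := by
    funext i
    have hi := (hmemS i).mp i.2
    have hleft : inner ℂ (Φ (U g⁻¹ (x i)) χ) (Φ u χ) =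
        ∑ l : S, (starRingEnd ℂ) (Φ (U g⁻¹ (x i)) χ l) * Φ u χ l := by
      rw [lp.inner_eq_tsum, tsum_eq_sum (s := S), ← Finset.sum_coe_sort]
      · exact Finset.sum_congr rfl fun l _ => by rw [RCLike.inner_apply, mul_comm]
      · intro l hl
        rw [hzero g⁻¹ i l (by simpa using (hmemS l).not.mp hl), inner_zero_left]
    have hright : inner ℂ (Φ (x i) χ) (Φ (U g u) χ) = sqrtDensity σ i χ * Φ (U g u) χ i := by
      rw [hgen, inner_smul_left, lp.inner_single_left, hconj]
      simp
    have := (hu i).symm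
    rw [hleft, hright] at this
    simp only [F, B, Matrix.mulVec, dotProduct]
    rw [eq_div_of_mul_eq hi ((mul_comm _ _).trans this), Finset.sum_div]
    exact Finset.sum_congr rfl fun l _ => by ring
  refine dvd_card_of_fiber U S (fun i => x i) (fun i => sqrtDensity σ i χ)
    (fun i => (hmemS i).mp i.2) F (fun i => ?_) B (fun g g' j => hB g _ fun i => hsymm g g' i j)
    fun r hr j => ⟨fun k => F (d r j k), ?_⟩
  · funext l
    simp only [F, hgen]
    rw [lp.coeFn_smul, Pi.smul_apply, lp.single_apply, Pi.smul_apply, Pi.single_apply,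
      Pi.single_apply]
    simp only [Subtype.ext_iff]
  · rw [tendsto_pi_nhds]
    intro l
    refine (((lp.evalCLM ℂ (fun _ : ℕ => ℂ) 2 (l : ℕ)).continuous.tendsto _).comp
      (hlim r j hr)).congr fun k => ?_
    rw [Pi.sub_apply, ← hB (eDiff n r) _ fun i => hsymm' (eDiff n r) i r j k]
    rfl

/-- If `W` has simple spectrum, then over almost every point the fiber is spanned by the values of
the first `n` translates of the cyclic vector. -/
lemma IsSpectralModel.ae_mem_span {n : ℕ} [NeZero n] {W : H ≃ₗᵢ[ℂ] H} {x : ℕ → H}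
    {σ : ℕ → Measure (AddCircle (1 : ℝ))} {Φ : H →ₗᵢ[ℂ] Lp (lp (fun _ : ℕ => ℂ) 2) 2 (σ 0)}
    (hΦ : IsSpectralModel (W ^ n) x σ Φ) {x₀ : H}
    (hx₀ : (zCyclicSpace W x₀).topologicalClosure = ⊤) (u : H) :
    ∀ᵐ χ ∂(σ 0), Φ u χ ∈
      Submodule.span ℂ (Set.range fun j : Fin n => Φ ((W ^ (j : ℕ)) x₀) χ) := by
  let N : AddCircle (1 : ℝ) → Submodule ℂ (lp (fun _ : ℕ => ℂ) 2) := fun χ =>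
    Submodule.span ℂ (Set.range fun j : Fin n => Φ ((W ^ (j : ℕ)) x₀) χ)
  let S : Submodule ℂ H :=
    { carrier := {u | ∀ᵐ χ ∂(σ 0), Φ u χ ∈ N χ}
      zero_mem' := by
        simp only [Set.mem_ofPred_eq, map_zero]
        filter_upwards [Lp.coeFn_zero (lp (fun _ : ℕ => ℂ) 2) 2 (σ 0)] with χ hχ
        rw [hχ]
        exact zero_mem _
      add_mem' := fun {a b} ha hb => by
        simp only [Set.mem_ofPred_eq, map_add] at ha hb ⊢
        filter_upwards [ha, hb, Lp.coeFn_add (Φ a) (Φ b)] with χ h1 h2 h3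
        rw [h3]
        exact add_mem h1 h2
      smul_mem' := fun c a ha => by
        simp only [Set.mem_ofPred_eq, map_smul] at ha ⊢
        filter_upwards [ha, Lp.coeFn_smul c (Φ a)] with χ h1 h2
        rw [h2]
        exact Submodule.smul_mem _ _ h1 }
  have hS : zCyclicSpace W x₀ ≤ S := by
    refine Submodule.span_le.mpr ?_
    rintro _ ⟨p, rfl⟩
    change ∀ᵐ χ ∂(σ 0), _
    have hn : (0 : ℤ) < n := by exact_mod_cast NeZero.pos n
    obtain ⟨j, hj⟩ := Int.eq_ofNat_of_zero_le (Int.emod_nonneg p hn.ne')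
    have hjn : j < n := by
      have := Int.emod_lt_of_pos p hn
      omega
    have hp : (W ^ p) x₀ = ((W ^ n) ^ (p / n)) ((W ^ j) x₀) := by
      rw [← zpow_natCast W n, ← zpow_mul, ← zpow_natCast W j, ← zpow_add_apply, ← hj,
        Int.mul_ediv_add_emod]
    rw [hp]
    filter_upwards [hΦ.apply_zpow ((W ^ j) x₀) (p / n)] with χ hχ
    rw [hχ]
    exact Submodule.smul_mem _ _ (Submodule.subset_span ⟨⟨j, hjn⟩, rfl⟩)
  have hcl : u ∈ closure (S : Set H) := by
    have := Submodule.topologicalClosure_mono hS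
    rw [hx₀] at this
    exact this Submodule.mem_top
  obtain ⟨d, hd, hlim, -⟩ := exists_seq_tendsto_ae Φ.continuous Φ.continuous hcl
  filter_upwards [hlim, ae_all_iff.mpr hd] with χ hχ hmem
  have : FiniteDimensional ℂ (N χ) := FiniteDimensional.span_of_finite ℂ (Set.finite_range _)
  exact (Submodule.closed_of_finiteDimensional (N χ)).mem_of_tendsto hχ (Eventually.of_forall hmem)

lemma IsSpectralModel.ae_card_le {n : ℕ} [NeZero n] {W : H ≃ₗᵢ[ℂ] H} {x : ℕ → H}
    {σ : ℕ → Measure (AddCircle (1 : ℝ))} {Φ : H →ₗᵢ[ℂ] Lp (lp (fun _ : ℕ => ℂ) 2) 2 (σ 0)}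
    (hΦ : IsSpectralModel (W ^ n) x σ Φ) {x₀ : H}
    (hx₀ : (zCyclicSpace W x₀).topologicalClosure = ⊤) :
    ∀ᵐ χ ∂(σ 0), ∃ S : Finset ℕ, (S : Set ℕ) = fiberSupport σ χ ∧ S.card ≤ n := by
  filter_upwards [ae_all_iff.mpr fun i => hΦ.ae_mem_span hx₀ (x i),
    ae_all_iff.mpr hΦ.apply_generator] with χ hspan hgen
  let v : fiberSupport σ χ → lp (fun _ : ℕ => ℂ) 2 := fun i => lp.single 2 (i : ℕ) (1 : ℂ)
  have hv : LinearIndependent ℂ v := by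
    refine Orthonormal.linearIndependent (𝕜 := ℂ) ⟨fun i => by simp [v, lp.norm_single],
      fun i j hij => ?_⟩
    simp [v, lp.inner_single_left, lp.single_apply, Subtype.coe_ne_coe.mpr hij]
  have hrange : Set.range v ≤
      Submodule.span ℂ (Set.range fun j : Fin n => Φ ((W ^ (j : ℕ)) x₀) χ) := by
    rintro _ ⟨i, rfl⟩
    have := hspan i
    rwa [hgen, Submodule.smul_mem_iff _ i.2] at this
  have hfin : Finite (fiberSupport σ χ) :=
    hv.finite_of_le_span_finite v _ hrange
  have := Fintype.ofFinite (fiberSupport σ χ)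
  refine ⟨(fiberSupport σ χ).toFinset, Set.coe_toFinset _, ?_⟩
  rw [Set.toFinset_card]
  have := Fintype.ofFinite (Set.range fun j : Fin n => Φ ((W ^ (j : ℕ)) x₀) χ)
  have hcard := linearIndependent_le_span' v hv _ hrange
  rw [Cardinal.mk_fintype, Nat.cast_le] at hcard
  exact hcard.trans ((Fintype.card_range_le _).trans (Fintype.card_fin n).le)

lemma ae_zero_mem_fiberSupport (σ : ℕ → Measure (AddCircle (1 : ℝ))) [IsFiniteMeasure (σ 0)] :
    ∀ᵐ χ ∂(σ 0), 0 ∈ fiberSupport σ χ := by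
  filter_upwards [Measure.rnDeriv_self (σ 0)] with χ hχ
  simp [fiberSupport, sqrtDensity, hχ]

end Fibers

end SpectralMultiplicity

/-- **(Ageev, Danilenko).**  Fix `n ≥ 1` and let `G = ℤⁿ ⋊_L ℤ` where `L` cyclically
permutes the basis of `ℤⁿ`.  For every unitary representation `U` of `G` on a separable
Hilbert space such that `U_{e₁ - Lʳe₁}` has no non-trivial fixed vectors for `1 ≤ r < n`,
the essential values of the multiplicity function of `U_{e_{n+1}}` are multiples of `n`;
if moreover `U_{e₀}` has a simple spectrum, then `U_{e_{n+1}}` has uniform multiplicity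
`n`. -/
theorem ageev_danilenko (n : ℕ) [NeZero n] [TopologicalSpace.SeparableSpace H]
    (U : AgeevGroup n →* (H ≃ₗᵢ[ℂ] H))
    (hfix : ∀ r : ℕ, 1 ≤ r → ∀ hr : r < n, ∀ x : H,
      U (eDiff n ⟨r, hr⟩) x = x → x = 0) :
    (∀ (x : ℕ → H) (σ : ℕ → Measure (AddCircle (1 : ℝ))),
        IsSpectralDecompositionZ (U (eTop n)) x σ →
        ∀ᵐ χ ∂(σ 0), (∃ k : ℕ, multiplicityFun σ χ = (n : ℝ≥0∞) * (k : ℝ≥0∞)) ∨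
          multiplicityFun σ χ = ∞) ∧
    ((∃ x₀ : H, (zCyclicSpace (U (e₀ n)) x₀).topologicalClosure = ⊤) →
      ∀ (x : ℕ → H) (σ : ℕ → Measure (AddCircle (1 : ℝ))),
        IsSpectralDecompositionZ (U (eTop n)) x σ →
        ∀ᵐ χ ∂(σ 0), multiplicityFun σ χ = (n : ℝ≥0∞)) := by
  have hfix' (r : Fin n) (hr : r ≠ 0) (u : H) (hu : U (eDiff n r) u = u) : u = 0 :=
    hfix r (Nat.one_le_iff_ne_zero.mpr fun h => hr (Fin.ext h)) r.2 u hu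
  refine ⟨fun x σ h => ?_, fun ⟨x₀, hx₀⟩ x σ h => ?_⟩
  · obtain ⟨Φ, hΦ⟩ := h.exists_isSpectralModel
    filter_upwards [multiplicityFun_eq_tsum_fiberSupport h.finite, hΦ.ae_dvd_card hfix']
      with χ hM hdvd
    rw [hM]
    rcases (fiberSupport σ χ).finite_or_infinite with hfin | hinf
    · left
      obtain ⟨S, hS⟩ := hfin.exists_finset_coe
      obtain ⟨k, hk⟩ := hdvd S hS
      exact ⟨k, by rw [← hS, tsum_one_eq_card, hk, Nat.cast_mul]⟩
    · right
      have := hinf.to_subtype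
      exact ENNReal.tsum_const_eq_top_of_ne_zero one_ne_zero
  · obtain ⟨Φ, hΦ⟩ := h.exists_isSpectralModel
    have hΦ' : IsSpectralModel (U (e₀ n) ^ n) x σ Φ := by
      rwa [← map_pow, e₀_pow]
    have := h.finite 0
    filter_upwards [multiplicityFun_eq_tsum_fiberSupport h.finite, hΦ.ae_dvd_card hfix',
      hΦ'.ae_card_le hx₀, ae_zero_mem_fiberSupport σ] with χ hM hdvd hle h0
    obtain ⟨S, hS, hle⟩ := hle
    have hpos : 0 < S.card := Finset.card_pos.mpr ⟨0, by rwa [← Finset.mem_coe, hS]⟩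
    rw [hM, ← hS, tsum_one_eq_card, hle.antisymm (Nat.le_of_dvd hpos (hdvd S hS))]
end

section
/- Let 𝒮 = (S_a)_{a∈𝔸} and 𝒯 = (T_a)_{a∈𝔸} be ergodic measure-preserving actions of a locally compact second countable Abelian group 𝔸 on standard probability Borel spaces (X, ℬ, μ) and (Y, 𝒞, ν) respectively. Assume both Koopman representations have purely discrete spectrum and the groups of eigenvalues of 𝒮 and 𝒯 (subgroups of Â) coincide. Then 𝒮 and 𝒯 are measure-theoretically isomorphic. (Halmos–von Neumann Theorem) -/
open MeasureTheory
open scoped symmDiff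

variable {A : Type*} [CommGroup A] [TopologicalSpace A] [IsTopologicalGroup A]
  [LocallyCompactSpace A] [SecondCountableTopology A]

/-- A measure-preserving `A`-action is ergodic: every set which is a.e. invariant under
all `S a` has measure `0` or `1`. -/
def ErgodicAction {X : Type*} [MeasurableSpace X] (S : A → X → X) (μ : Measure X) : Prop :=
  ∀ s : Set X, MeasurableSet s → (∀ a : A, μ (s ∆ (S a ⁻¹' s)) = 0) →
    μ s = 0 ∨ μ s = 1

/-- The eigenvectors of the Koopman representation of the action `S` in `L²(μ)`:
`g` with `g ∘ S_a = χ(a)·g` for some character `χ` of `A`. -/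
def koopmanEigenvectors {X : Type*} [MeasurableSpace X] (S : A → X → X) (μ : Measure X) :
    Set (Lp ℂ 2 μ) :=
  {g | ∃ χ : PontryaginDual A, ∀ a : A,
    (fun x => g (S a x)) =ᵐ[μ] fun x => (χ a : ℂ) * g x}

/-- The Koopman representation of the action `S` has purely discrete spectrum: `L²(μ)` is
the closed linear span of its eigenvectors. -/
def HasDiscreteSpectrum {X : Type*} [MeasurableSpace X] (S : A → X → X)
    (μ : Measure X) : Prop :=
  (Submodule.span ℂ (koopmanEigenvectors S μ)).topologicalClosure = ⊤

/-- The group of eigenvalues of the Koopman representation of the action `S`. -/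
def koopmanEigenvalues {X : Type*} [MeasurableSpace X] (S : A → X → X) (μ : Measure X) :
    Set (PontryaginDual A) :=
  {χ | ∃ g : Lp ℂ 2 μ, g ≠ 0 ∧ ∀ a : A,
    (fun x => g (S a x)) =ᵐ[μ] fun x => (χ a : ℂ) * g x}

open Filter

noncomputable section

instance Circle.instMeasurableSpace : MeasurableSpace Circle := borel Circle

instance Circle.instBorelSpace : BorelSpace Circle := ⟨rfl⟩

/-- `Circle` is divisible, so an embedded copy of it in an abelian group is a retract. -/
theorem Circle.exists_retraction {G : Type*} [CommGroup G] (i : Circle →* G)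
    (hi : Function.Injective i) : ∃ r : G →* Circle, ∀ z, r (i z) = z := by
  let _ : DivisibleBy (Additive Circle) ℤ := divisibleByOfSMulRightSurj _ _ fun {n} hn z => by
    refine ⟨Additive.ofMul (Circle.exp (Complex.arg (z.toMul : ℂ) / n)), ?_⟩
    change Additive.ofMul (Circle.exp _ ^ n) = z
    rw [← Circle.exp_intCast_mul, mul_div_cancel₀ _ (Int.cast_ne_zero.mpr hn), Circle.exp_arg]
    rfl
  obtain ⟨r, hr⟩ := (Module.Baer.of_divisible (Additive Circle)).extension_property_addMonoidHom
    (MonoidHom.toAdditive i) (fun _ _ h => hi h) (AddMonoidHom.id _)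
  exact ⟨MonoidHom.toAdditive.symm r, fun z => DFunLike.congr_fun hr (Additive.ofMul z)⟩

/-- A measurable function invariant under an ergodic action is almost everywhere constant. -/
theorem ErgodicAction.exists_ae_eq_const {G X : Type*} [MeasurableSpace X] {μ : Measure X}
    {S : G → X → X} [IsProbabilityMeasure μ] (hS : ErgodicAction S μ)
    {β : Type*} [MeasurableSpace β] [MeasurableSpace.CountablySeparated β] [Nonempty β]
    {φ : X → β} (hφ : Measurable φ) (hinv : ∀ a, ∀ᵐ x ∂μ, φ (S a x) = φ x) :
    ∃ c, ∀ᵐ x ∂μ, φ x = c := by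
  refine exists_eventuallyEq_const_of_forall_separating (l := ae μ) MeasurableSet fun U hU => ?_
  have h := hS (φ ⁻¹' U) (hφ hU) fun a => by
    rw [measure_symmDiff_eq_zero_iff]
    filter_upwards [hinv a] with x hx
    change (φ x ∈ U) = (φ (S a x) ∈ U)
    rw [hx]
  rcases h with h | h
  · exact Or.inr (measure_eq_zero_iff_ae_notMem.mp h)
  · exact Or.inl ((mem_ae_iff_prob_eq_one (hφ hU)).mpr h)

section Eigenfunctions

variable {G : Type*} [CommGroup G] [TopologicalSpace G]
  {X : Type*} [MeasurableSpace X] {μ : Measure X} {S : G → X → X}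

/-- `f` is a circle-valued eigenfunction of the action `S` with eigenvalue `χ`. -/
def IsEigenfunction (S : G → X → X) (μ : Measure X) (χ : PontryaginDual G) (f : X → Circle) :
    Prop :=
  ∀ a, ∀ᵐ x ∂μ, f (S a x) = χ a * f x

namespace IsEigenfunction

variable {χ ψ : PontryaginDual G} {f g : X → Circle}

theorem one : IsEigenfunction S μ 1 fun _ => 1 := fun a => by simp

theorem mul (hf : IsEigenfunction S μ χ f) (hg : IsEigenfunction S μ ψ g) :
    IsEigenfunction S μ (χ * ψ) fun x => f x * g x := fun a => by
  filter_upwards [hf a, hg a] with x hx hy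
  rw [hx, hy, mul_mul_mul_comm]
  rfl

theorem inv (hf : IsEigenfunction S μ χ f) : IsEigenfunction S μ χ⁻¹ fun x => (f x)⁻¹ :=
    fun a => by
  filter_upwards [hf a] with x hx
  rw [hx, mul_inv]
  rfl

theorem mul_const (hf : IsEigenfunction S μ χ f) (c : Circle) :
    IsEigenfunction S μ χ fun x => f x * c := fun a => by
  filter_upwards [hf a] with x hx
  rw [hx, mul_assoc]

theorem congr (hf : IsEigenfunction S μ χ f) (hS : ∀ a, MeasurePreserving (S a) μ μ)
    (hfg : f =ᵐ[μ] g) : IsEigenfunction S μ χ g := fun a => by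
  filter_upwards [hf a, hfg, (hS a).quasiMeasurePreserving.ae_eq_comp hfg] with x hx hx' hx''
  rw [← hx', ← hx]
  exact hx''.symm

/-- An eigenfunction with non-trivial eigenvalue has mean zero. -/
theorem integral_eq_zero (hf : IsEigenfunction S μ χ f) (hfm : Measurable f)
    (hS : ∀ a, MeasurePreserving (S a) μ μ) (hχ : χ ≠ 1) : ∫ x, (f x : ℂ) ∂μ = 0 := by
  obtain ⟨a, ha⟩ : ∃ a, χ a ≠ 1 := by
    by_contra! h
    exact hχ (PontryaginDual.ext h)
  have h₁ : ∫ x, (f (S a x) : ℂ) ∂μ = ∫ x, (f x : ℂ) ∂μ := by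
    rw [← integral_map (φ := S a) (f := fun x => (f x : ℂ)) (hS a).aemeasurable
      (by fun_prop), (hS a).map_eq]
  have h₂ : ∫ x, (f (S a x) : ℂ) ∂μ = χ a * ∫ x, (f x : ℂ) ∂μ := by
    rw [← integral_const_mul]
    refine integral_congr_ae ?_
    filter_upwards [hf a] with x hx
    rw [hx, Circle.coe_mul]
  have h₃ : ((χ a : ℂ) - 1) * ∫ x, (f x : ℂ) ∂μ = 0 := by rw [sub_mul, ← h₂, h₁]; ring
  refine (mul_eq_zero.mp h₃).resolve_left fun h => ha ?_
  exact Circle.ext (by simpa using sub_eq_zero.mp h)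

end IsEigenfunction

/-- The modulus of an eigenvector of an ergodic action is constant, so it is a multiple of a
circle-valued eigenfunction. -/
theorem ErgodicAction.exists_isEigenfunction [IsProbabilityMeasure μ] (hS : ErgodicAction S μ)
    {χ : PontryaginDual G} (hχ : χ ∈ koopmanEigenvalues S μ) :
    ∃ f, Measurable f ∧ IsEigenfunction S μ χ f := by
  obtain ⟨g, hg0, hg⟩ := hχ
  have hgm : Measurable g := (Lp.stronglyMeasurable g).measurable
  obtain ⟨c, hc⟩ := hS.exists_ae_eq_const (φ := fun x => ‖g x‖) (by fun_prop) fun a => by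
    filter_upwards [hg a] with x hx
    rw [hx, norm_mul, Circle.norm_coe, one_mul]
  have hc0 : c ≠ 0 := by
    rintro rfl
    refine hg0 (Lp.eq_zero_iff_ae_eq_zero.mpr ?_)
    filter_upwards [hc] with x hx using norm_eq_zero.mp hx
  refine ⟨fun x => Circle.exp (Complex.arg (g x)),
    Circle.exp.continuous.measurable.comp (Complex.measurable_arg.comp hgm), fun a => ?_⟩
  have hc' : ∀ᵐ x ∂μ, ‖g (S a x)‖ = c := by
    filter_upwards [hg a, hc] with x hx hx'
    rw [hx, norm_mul, Circle.norm_coe, one_mul, hx']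
  filter_upwards [hg a, hc, hc'] with x hx hx₁ hx₂
  have h₁ := Complex.norm_mul_exp_arg_mul_I (g x)
  have h₂ := Complex.norm_mul_exp_arg_mul_I (g (S a x))
  rw [hx₁] at h₁
  rw [hx₂] at h₂
  refine Circle.ext (mul_left_cancel₀ (Complex.ofReal_ne_zero.mpr hc0) ?_)
  rw [Circle.coe_mul, Circle.coe_exp, Circle.coe_exp, h₂, mul_left_comm, h₁, hx]

/-- A circle-valued eigenfunction, as an element of `L²`. -/
def circleToLp [IsFiniteMeasure μ] (f : X → Circle) (hf : Measurable f) : Lp ℂ 2 μ :=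
  MemLp.toLp (fun x => (f x : ℂ))
    (MemLp.of_bound (Measurable.aestronglyMeasurable (by fun_prop)) 1
      (Eventually.of_forall fun x => (Circle.norm_coe (f x)).le))

theorem coeFn_circleToLp [IsFiniteMeasure μ] (f : X → Circle) (hf : Measurable f) :
    circleToLp (μ := μ) f hf =ᵐ[μ] fun x => (f x : ℂ) :=
  MemLp.coeFn_toLp _

theorem IsEigenfunction.mem_koopmanEigenvalues [IsProbabilityMeasure μ]
    {χ : PontryaginDual G} {f : X → Circle} (hf : IsEigenfunction S μ χ f) (hfm : Measurable f)
    (hS : ∀ a, MeasurePreserving (S a) μ μ) : χ ∈ koopmanEigenvalues S μ := by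
  have h := coeFn_circleToLp (μ := μ) f hfm
  refine ⟨circleToLp f hfm, fun h0 => ?_, fun a => ?_⟩
  · have : ∀ᵐ _ ∂μ, False := by
      filter_upwards [h, Lp.eq_zero_iff_ae_eq_zero.mp h0] with x hx hx'
      exact (f x).coe_ne_zero (hx.symm.trans hx')
    exact this.exists.choose_spec
  · filter_upwards [hf a, h, (hS a).quasiMeasurePreserving.ae_eq_comp h] with x hx hx' hx''
    rw [hx', ← Circle.coe_mul, ← hx]
    exact hx''

/-- The eigenvalues of an ergodic action are simple. -/
theorem ErgodicAction.exists_eq_const_mul [IsProbabilityMeasure μ] (hS : ErgodicAction S μ)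
    {χ : PontryaginDual G} {f : X → Circle} (hf : IsEigenfunction S μ χ f) (hfm : Measurable f)
    {g : X → ℂ} (hgm : Measurable g) (hg : ∀ a, ∀ᵐ x ∂μ, g (S a x) = χ a * g x) :
    ∃ c : ℂ, ∀ᵐ x ∂μ, g x = c * f x := by
  obtain ⟨c, hc⟩ := hS.exists_ae_eq_const (φ := fun x => g x * ((f x)⁻¹ : Circle))
    (by fun_prop) fun a => by
      filter_upwards [hf a, hg a] with x hx hx'
      rw [hx, hx', mul_inv, Circle.coe_mul, mul_mul_mul_comm, ← Circle.coe_mul, mul_inv_cancel,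
        Circle.coe_one, one_mul]
  refine ⟨c, ?_⟩
  filter_upwards [hc] with x hx
  rw [← hx, mul_assoc, ← Circle.coe_mul, inv_mul_cancel, Circle.coe_one, mul_one]

/-- A choice of circle-valued eigenfunctions which is multiplicative in the eigenvalue. -/
structure IsEigenfamily (S : G → X → X) (μ : Measure X) (Γ : Subgroup (PontryaginDual G))
    (f : Γ → X → Circle) : Prop where
  measurable : ∀ χ, Measurable (f χ)
  isEigenfunction : ∀ χ : Γ, IsEigenfunction S μ χ (f χ)
  mul : ∀ χ ψ, ∀ᵐ x ∂μ, f (χ * ψ) x = f χ x * f ψ x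

/-- The eigenvalues of an ergodic action form a group. -/
theorem ErgodicAction.exists_subgroup_eq_koopmanEigenvalues [IsProbabilityMeasure μ]
    (hS : ErgodicAction S μ) (hSp : ∀ a, MeasurePreserving (S a) μ μ) :
    ∃ Γ : Subgroup (PontryaginDual G), (Γ : Set (PontryaginDual G)) = koopmanEigenvalues S μ :=
  ⟨{ carrier := koopmanEigenvalues S μ
     one_mem' := IsEigenfunction.one.mem_koopmanEigenvalues measurable_const hSp
     mul_mem' := fun hχ hψ => by
      obtain ⟨f, hfm, hf⟩ := hS.exists_isEigenfunction hχ
      obtain ⟨g, hgm, hg⟩ := hS.exists_isEigenfunction hψ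
      exact (hf.mul hg).mem_koopmanEigenvalues (by fun_prop) hSp
     inv_mem' := fun hχ => by
      obtain ⟨f, hfm, hf⟩ := hS.exists_isEigenfunction hχ
      exact hf.inv.mem_koopmanEigenvalues (by fun_prop) hSp }, rfl⟩

/-- An ergodic action has a multiplicative family of eigenfunctions. -/
theorem ErgodicAction.exists_isEigenfamily [IsProbabilityMeasure μ]
    (hS : ErgodicAction S μ) (hSp : ∀ a, MeasurePreserving (S a) μ μ)
    {Γ : Subgroup (PontryaginDual G)} (hΓ : (Γ : Set (PontryaginDual G)) ⊆ koopmanEigenvalues S μ) :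
    ∃ f, IsEigenfamily S μ Γ f := by
  let i : Circle →* (X →ₘ[μ] Circle) :=
    { toFun := AEEqFun.const X, map_one' := rfl, map_mul' := fun _ _ => rfl }
  have hi (z : Circle) : (i z : X → Circle) =ᵐ[μ] fun _ => z := AEEqFun.coeFn_const X z
  obtain ⟨r, hr⟩ := Circle.exists_retraction i fun z w h => by
    have : ∀ᵐ _ ∂μ, z = w := by
      filter_upwards [hi z, hi w] with x hz hw
      rw [← hz, ← hw, h]
    simpa using this
  have key (χ : Γ) : ∃ F : X →ₘ[μ] Circle, r F = 1 ∧ IsEigenfunction S μ χ F := by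
    obtain ⟨f, hfm, hf⟩ := hS.exists_isEigenfunction (hΓ χ.2)
    let E : X →ₘ[μ] Circle := AEEqFun.mk f hfm.aestronglyMeasurable
    refine ⟨E * i (r E)⁻¹, by rw [map_mul, hr, mul_inv_cancel], ?_⟩
    refine (hf.mul_const (r E)⁻¹).congr hSp ?_
    filter_upwards [AEEqFun.coeFn_mul E (i (r E)⁻¹), hi (r E)⁻¹,
      AEEqFun.coeFn_mk f hfm.aestronglyMeasurable] with x h₁ h₂ h₃
    rw [h₁, Pi.mul_apply, h₂, h₃]
  choose F hF1 hF using key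
  refine ⟨fun χ => F χ, fun χ => (F χ).measurable, hF, fun χ ψ => ?_⟩
  have hinv := (hF (χ * ψ)).inv.mul ((hF χ).mul (hF ψ))
  obtain ⟨c, hc⟩ := hS.exists_ae_eq_const
    (φ := fun x => (F (χ * ψ) x)⁻¹ * (F χ x * F ψ x)) (by fun_prop) fun a => by
      filter_upwards [hinv a] with x hx
      rw [hx, Subgroup.coe_mul, inv_mul_cancel, PontryaginDual.one_apply, one_mul]
  have hFc : F χ * F ψ = F (χ * ψ) * i c := by
    refine AEEqFun.ext ?_
    filter_upwards [AEEqFun.coeFn_mul (F χ) (F ψ), AEEqFun.coeFn_mul (F (χ * ψ)) (i c), hi c, hc]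
      with x h₁ h₂ h₃ h₄
    rw [h₁, h₂, Pi.mul_apply, Pi.mul_apply, h₃, ← h₄, mul_inv_cancel_left]
  have hc1 : c = 1 := by simpa [hF1, hr] using (congrArg r hFc).symm
  filter_upwards [hc] with x hx
  rw [hc1, inv_mul_eq_one] at hx
  exact hx

namespace IsEigenfamily

variable {Γ : Subgroup (PontryaginDual G)} {f : Γ → X → Circle}

theorem map_one (hf : IsEigenfamily S μ Γ f) : ∀ᵐ x ∂μ, f 1 x = 1 := by
  filter_upwards [hf.mul 1 1] with x hx
  rwa [mul_one, left_eq_mul] at hx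

theorem map_inv (hf : IsEigenfamily S μ Γ f) (χ : Γ) : ∀ᵐ x ∂μ, f χ⁻¹ x = (f χ x)⁻¹ := by
  filter_upwards [hf.mul χ χ⁻¹, hf.map_one] with x hx hx'
  rw [mul_inv_cancel, hx'] at hx
  exact eq_inv_of_mul_eq_one_right hx.symm

theorem integral_eq [IsProbabilityMeasure μ] (hf : IsEigenfamily S μ Γ f)
    (hSp : ∀ a, MeasurePreserving (S a) μ μ) (χ : Γ) [Decidable (χ = 1)] :
    ∫ x, (f χ x : ℂ) ∂μ = if χ = 1 then 1 else 0 := by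
  split_ifs with h
  · subst h
    have : (fun x => (f 1 x : ℂ)) =ᵐ[μ] fun _ => 1 := by
      filter_upwards [hf.map_one] with x hx
      rw [hx, Circle.coe_one]
    rw [integral_congr_ae this]
    simp
  · exact (hf.isEigenfunction χ).integral_eq_zero (hf.measurable χ) hSp (by simpa using h)

/-- The members of an eigenfamily are orthonormal in `L²`. -/
theorem orthonormal [IsProbabilityMeasure μ] (hf : IsEigenfamily S μ Γ f)
    (hSp : ∀ a, MeasurePreserving (S a) μ μ) :
    Orthonormal ℂ fun χ => circleToLp (μ := μ) (f χ) (hf.measurable χ) := by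
  classical
  rw [orthonormal_iff_ite]
  intro χ ψ
  rw [L2.inner_def]
  have : (fun x => inner ℂ (circleToLp (μ := μ) (f χ) (hf.measurable χ) x)
      (circleToLp (μ := μ) (f ψ) (hf.measurable ψ) x)) =ᵐ[μ] fun x => (f (χ⁻¹ * ψ) x : ℂ) := by
    filter_upwards [coeFn_circleToLp (μ := μ) (f χ) (hf.measurable χ),
      coeFn_circleToLp (μ := μ) (f ψ) (hf.measurable ψ), hf.mul χ⁻¹ ψ, hf.map_inv χ]
      with x h₁ h₂ h₃ h₄
    rw [h₁, h₂, h₃, h₄, Circle.coe_mul, Circle.coe_inv_eq_conj, RCLike.inner_apply, mul_comm]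
  rw [integral_congr_ae this, hf.integral_eq hSp]
  simp only [inv_mul_eq_one]

theorem countable [MeasurableSpace.CountablyGenerated X] [IsProbabilityMeasure μ]
    (hf : IsEigenfamily S μ Γ f) (hSp : ∀ a, MeasurePreserving (S a) μ μ) : Countable Γ := by
  have ho := hf.orthonormal hSp
  set u : Γ → Lp ℂ 2 μ := fun χ => circleToLp (μ := μ) (f χ) (hf.measurable χ)
  have : Fact ((2 : ENNReal) ≠ ⊤) := ⟨by simp⟩
  have hd (χ : Γ) : ∃ n, dist (u χ) (TopologicalSpace.denseSeq (Lp ℂ 2 μ) n) < 1 / 2 :=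
    (TopologicalSpace.denseRange_denseSeq (Lp ℂ 2 μ)).exists_dist_lt (u χ) (by norm_num)
  choose n hn using hd
  refine Function.Injective.countable (f := n) fun χ ψ h => ?_
  by_contra hne
  have h₁ : ‖u χ - u ψ‖ < 1 := by
    rw [← dist_eq_norm]
    have := hn ψ
    rw [← h] at this
    linarith [hn χ, dist_triangle_right (u χ) (u ψ)
      (TopologicalSpace.denseSeq (Lp ℂ 2 μ) (n χ))]
  have h₂ := norm_sub_sq (𝕜 := ℂ) (u χ) (u ψ)
  rw [ho.1 χ, ho.1 ψ, ho.2 hne] at h₂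
  norm_num at h₂
  nlinarith [norm_nonneg (u χ - u ψ)]

/-- The joint distribution of an eigenfamily depends only on the group of eigenvalues. -/
theorem map_eq {Y : Type*} [MeasurableSpace Y] {ν : Measure Y} {T : G → Y → Y} {g : Γ → Y → Circle}
    [IsProbabilityMeasure μ] [IsProbabilityMeasure ν] [Countable Γ]
    (hf : IsEigenfamily S μ Γ f) (hg : IsEigenfamily T ν Γ g)
    (hSp : ∀ a, MeasurePreserving (S a) μ μ) (hTp : ∀ a, MeasurePreserving (T a) ν ν) :
    μ.map (fun x χ => f χ x) = ν.map (fun y χ => g χ y) := by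
  classical
  have hfm : Measurable fun x χ => f χ x := measurable_pi_lambda _ hf.measurable
  have hgm : Measurable fun y χ => g χ y := measurable_pi_lambda _ hg.measurable
  have := Measure.isProbabilityMeasure_map (μ := μ) hfm.aemeasurable
  have := Measure.isProbabilityMeasure_map (μ := ν) hgm.aemeasurable
  let e (χ : Γ) : BoundedContinuousFunction (Γ → Circle) ℂ :=
    .mkOfCompact ⟨fun z => (z χ : ℂ), by fun_prop⟩
  have he (χ : Γ) (z : Γ → Circle) : e χ z = z χ := rfl
  have : TopologicalSpace.IsCompletelyMetrizableSpace (Γ → Circle) := inferInstance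
  have : PolishSpace (Γ → Circle) := { }
  refine ext_of_forall_mem_subalgebra_integral_eq_of_polish (𝕜 := ℂ)
    (A := StarAlgebra.adjoin ℂ (Set.range e)) ?_ ?_
  · intro z w hzw
    obtain ⟨χ, hχ⟩ := Function.ne_iff.mp hzw
    refine ⟨_, ⟨_, ⟨e χ, StarAlgebra.subset_adjoin ℂ _ ⟨χ, rfl⟩, rfl⟩, rfl⟩, ?_⟩
    exact fun h => hχ (Circle.ext h)
  have monomial (m) (hm : m ∈ Submonoid.closure (Set.range e ∪ star (Set.range e))) :
      ∃ χ : Γ, (∀ᵐ x ∂μ, m (fun χ => f χ x) = f χ x) ∧ ∀ᵐ y ∂ν, m (fun χ => g χ y) = g χ y := by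
    induction hm using Submonoid.closure_induction with
    | mem m hm =>
      rcases hm with ⟨χ, rfl⟩ | ⟨χ, hχ⟩
      · exact ⟨χ, by simp [he], by simp [he]⟩
      · obtain rfl : star (e χ) = m := by rw [hχ, star_star]
        refine ⟨χ⁻¹, ?_, ?_⟩
        · filter_upwards [hf.map_inv χ] with x hx
          rw [hx, Circle.coe_inv_eq_conj]
          rfl
        · filter_upwards [hg.map_inv χ] with x hx
          rw [hx, Circle.coe_inv_eq_conj]
          rfl
    | one =>
      refine ⟨1, ?_, ?_⟩
      · filter_upwards [hf.map_one] with x hx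
        simp [hx]
      · filter_upwards [hg.map_one] with x hx
        simp [hx]
    | mul m m' _ _ ih ih' =>
      obtain ⟨χ, h₁, h₂⟩ := ih
      obtain ⟨χ', h₁', h₂'⟩ := ih'
      refine ⟨χ * χ', ?_, ?_⟩
      · filter_upwards [h₁, h₁', hf.mul χ χ'] with x hx hx' hxm
        rw [BoundedContinuousFunction.mul_apply, hx, hx', hxm, Circle.coe_mul]
      · filter_upwards [h₂, h₂', hg.mul χ χ'] with x hx hx' hxm
        rw [BoundedContinuousFunction.mul_apply, hx, hx', hxm, Circle.coe_mul]
  intro m hm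
  rw [← StarSubalgebra.mem_toSubalgebra, StarAlgebra.adjoin_toSubalgebra,
    ← Subalgebra.mem_toSubmodule, Algebra.adjoin_eq_span] at hm
  induction hm using Submodule.span_induction with
  | mem m hm =>
    obtain ⟨χ, h₁, h₂⟩ := monomial m hm
    rw [integral_map hfm.aemeasurable m.continuous.aestronglyMeasurable,
      integral_map hgm.aemeasurable m.continuous.aestronglyMeasurable,
      integral_congr_ae h₁, integral_congr_ae h₂, hf.integral_eq hSp, hg.integral_eq hTp]
  | zero => simp
  | add m m' _ _ ih ih' =>
    simp only [BoundedContinuousFunction.add_apply]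
    rw [integral_add (m.integrable _) (m'.integrable _),
      integral_add (m.integrable _) (m'.integrable _), ih, ih']
  | smul c m _ ih =>
    simp only [BoundedContinuousFunction.smul_apply, smul_eq_mul]
    rw [integral_const_mul, integral_const_mul, ih]

/-- If the action has discrete spectrum, the joint eigenfunction map is injective up to a null
set. -/
theorem exists_leftInverse [StandardBorelSpace X] [IsProbabilityMeasure μ]
    (hf : IsEigenfamily S μ Γ f) (hS : ErgodicAction S μ) (hdisc : HasDiscreteSpectrum S μ)
    (hΓ : koopmanEigenvalues S μ ⊆ Γ) :
    ∃ h : (Γ → Circle) → X, Measurable h ∧ ∀ᵐ x ∂μ, h (fun χ => f χ x) = x := by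
  have hfm : Measurable fun x χ => f χ x := measurable_pi_lambda _ hf.measurable
  have htop : lpMeas ℂ ℂ (MeasurableSpace.comap (fun x χ => f χ x) inferInstance) 2 μ = ⊤ := by
    refine top_unique (hdisc ▸ Submodule.topologicalClosure_minimal _ ?_
      (isClosed_aestronglyMeasurable hfm.comap_le))
    refine Submodule.span_le.mpr ?_
    rintro g ⟨χ, hg⟩
    by_cases hg0 : g = 0
    · rw [hg0]
      exact Submodule.zero_mem _
    let χ' : Γ := ⟨χ, hΓ ⟨g, hg0, hg⟩⟩
    obtain ⟨c, hc⟩ := hS.exists_eq_const_mul (hf.isEigenfunction χ') (hf.measurable χ')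
      (Lp.stronglyMeasurable g).measurable hg
    refine mem_lpMeas_iff_aestronglyMeasurable.mpr ⟨fun x => c * f χ' x, ?_, hc⟩
    refine Measurable.stronglyMeasurable ?_
    have : Measurable fun z : Γ → Circle => c * (z χ' : ℂ) := by fun_prop
    exact this.comp (comap_measurable _)
  let ι (x : X) : ℂ := (Real.arctan (embeddingReal X x) : ℝ)
  have hιm : Measurable ι :=
    Complex.measurable_ofReal.comp
      (Real.continuous_arctan.measurable.comp (measurableEmbedding_embeddingReal X).measurable)
  have hι : MeasurableEmbedding ι := hιm.measurableEmbedding fun x y h =>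
    (measurableEmbedding_embeddingReal X).injective
      (Real.arctan_injective (Complex.ofReal_injective h))
  have hιL : MemLp ι 2 μ := by
    refine MemLp.of_bound hιm.aestronglyMeasurable (Real.pi / 2) (Eventually.of_forall fun x => ?_)
    rw [Complex.norm_real, Real.norm_eq_abs, abs_le]
    exact ⟨(Real.neg_pi_div_two_lt_arctan _).le, (Real.arctan_lt_pi_div_two _).le⟩
  have hmem : hιL.toLp ι ∈ lpMeas ℂ ℂ (MeasurableSpace.comap (fun x χ => f χ x) inferInstance) 2 μ := htop ▸ Submodule.mem_top
  obtain ⟨k, hk, hιk⟩ := mem_lpMeas_iff_aestronglyMeasurable.mp hmem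
  obtain ⟨k', hk', rfl⟩ := hk.exists_eq_measurable_comp
  have : Nonempty X := nonempty_of_isProbabilityMeasure μ
  obtain ⟨p, hp, hpι⟩ := hι.exists_measurable_extend measurable_id fun _ => inferInstance
  refine ⟨p ∘ k', hp.comp hk'.measurable, ?_⟩
  filter_upwards [hιk, hιL.coeFn_toLp] with x hx hx'
  have : k' (fun χ => f χ x) = ι x := (hx.symm.trans hx' :)
  rw [Function.comp_apply, this]
  exact congrFun hpι x

end IsEigenfamily

end Eigenfunctions

end

/-- **Halmos–von Neumann Theorem.**  Two ergodic measure-preserving actions `S`, `T` of a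
l.c.s.c. Abelian group `A` on standard probability spaces, both with purely discrete
spectrum and with the same group of eigenvalues, are measure-theoretically isomorphic. -/
theorem halmos_von_neumann
    {X : Type*} [MeasurableSpace X] [StandardBorelSpace X]
    {Y : Type*} [MeasurableSpace Y] [StandardBorelSpace Y]
    (μ : Measure X) [IsProbabilityMeasure μ] (ν : Measure Y) [IsProbabilityMeasure ν]
    (S : A → X → X) (T : A → Y → Y)
    (hS1 : S 1 = id) (hSmul : ∀ a b : A, S (a * b) = S a ∘ S b)
    (hSmeas : ∀ a : A, Measurable (S a)) (hSpres : ∀ a : A, MeasurePreserving (S a) μ μ)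
    (hT1 : T 1 = id) (hTmul : ∀ a b : A, T (a * b) = T a ∘ T b)
    (hTmeas : ∀ a : A, Measurable (T a)) (hTpres : ∀ a : A, MeasurePreserving (T a) ν ν)
    (hSerg : ErgodicAction S μ) (hTerg : ErgodicAction T ν)
    (hSdisc : HasDiscreteSpectrum S μ) (hTdisc : HasDiscreteSpectrum T ν)
    (heig : koopmanEigenvalues S μ = koopmanEigenvalues T ν) :
    ∃ R : X → Y, Measurable R ∧ MeasurePreserving R μ ν ∧
      (∀ a : A, (fun x => R (S a x)) =ᵐ[μ] fun x => T a (R x)) ∧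
      ∃ R' : Y → X, Measurable R' ∧ MeasurePreserving R' ν μ ∧
        (fun x => R' (R x)) =ᵐ[μ] id ∧ (fun y => R (R' y)) =ᵐ[ν] id := by
  obtain ⟨Γ, hΓ⟩ := hSerg.exists_subgroup_eq_koopmanEigenvalues hSpres
  obtain ⟨f, hf⟩ := hSerg.exists_isEigenfamily hSpres hΓ.subset
  obtain ⟨g, hg⟩ := hTerg.exists_isEigenfamily hTpres (hΓ.trans heig).subset
  have := hf.countable hSpres
  have hmap := hf.map_eq hg hSpres hTpres
  obtain ⟨p, hp, hpf⟩ := hf.exists_leftInverse hSerg hSdisc hΓ.superset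
  obtain ⟨q, hq, hqg⟩ := hg.exists_leftInverse hTerg hTdisc (hΓ.trans heig).superset
  let Φ (x : X) (χ : Γ) : Circle := f χ x
  let Ψ (y : Y) (χ : Γ) : Circle := g χ y
  have hΦ : Measurable Φ := measurable_pi_lambda _ hf.measurable
  have hΨ : Measurable Ψ := measurable_pi_lambda _ hg.measurable
  change μ.map Φ = ν.map Ψ at hmap
  change ∀ᵐ x ∂μ, p (Φ x) = x at hpf
  change ∀ᵐ y ∂ν, q (Ψ y) = y at hqg
  refine ⟨q ∘ Φ, hq.comp hΦ, ⟨hq.comp hΦ, ?_⟩, fun a => ?_, p ∘ Ψ, hp.comp hΨ,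
    ⟨hp.comp hΨ, ?_⟩, ?_, ?_⟩
  · rw [← Measure.map_map hq hΦ, hmap, Measure.map_map hq hΨ]
    exact (Measure.map_congr hqg).trans Measure.map_id
  · have hν : ∀ᵐ y ∂ν, q (fun χ => χ.1 a * Ψ y χ) = T a (q (Ψ y)) := by
      filter_upwards [hqg, (hTpres a).quasiMeasurePreserving.ae hqg,
        ae_all_iff.mpr fun χ => hg.isEigenfunction χ a] with y h₁ h₂ h₃
      rw [h₁, ← funext h₃]
      exact h₂
    have hμ : ∀ᵐ x ∂μ, q (fun χ => χ.1 a * Φ x χ) = T a (q (Φ x)) := by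
      refine ae_of_ae_map hΦ.aemeasurable
        (p := fun z : Γ → Circle => q (fun χ => χ.1 a * z χ) = T a (q z)) ?_
      rw [hmap]
      refine (ae_map_iff hΨ.aemeasurable (measurableSet_eq_fun (hq.comp ?_)
        ((hTmeas a).comp hq))).mpr hν
      fun_prop
    filter_upwards [hμ, ae_all_iff.mpr fun χ => hf.isEigenfunction χ a] with x h₁ h₂
    change q (fun χ => f χ (S a x)) = T a (q (Φ x))
    rw [funext h₂]
    exact h₁
  · rw [← Measure.map_map hp hΨ, ← hmap, Measure.map_map hp hΦ]
    exact (Measure.map_congr hpf).trans Measure.map_id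
  · have h : ∀ᵐ x ∂μ, Ψ (q (Φ x)) = Φ x := by
      refine ae_of_ae_map hΦ.aemeasurable (p := fun z => Ψ (q z) = z) ?_
      rw [hmap]
      refine (ae_map_iff hΨ.aemeasurable
        (measurableSet_eq_fun (hΨ.comp hq) measurable_id)).mpr ?_
      filter_upwards [hqg] with y hy using congrArg Ψ hy
    filter_upwards [h, hpf] with x h₁ h₂
    simp only [Function.comp_apply, id, h₁, h₂]
  · have h : ∀ᵐ y ∂ν, Φ (p (Ψ y)) = Ψ y := by
      refine ae_of_ae_map hΨ.aemeasurable (p := fun z => Φ (p z) = z) ?_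
      rw [← hmap]
      refine (ae_map_iff hΦ.aemeasurable
        (measurableSet_eq_fun (hΦ.comp hp) measurable_id)).mpr ?_
      filter_upwards [hpf] with x hx using congrArg Φ hx
    filter_upwards [h, hqg] with y h₁ h₂
    simp only [Function.comp_apply, id, h₁, h₂]
end
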